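/- Define the triple sums S_A = Σ_{z1,z2,z3} (−1)^(z1+z2+z3) · [(g−h+k+z1)!(a+c−h+z1)!(2h−z1)! / (z1!(g+h−k−z1)!(c−a+h−z1)!)] · [(2d−z2)!(c−d+f+z2)! / (z2!(d−b+k−z2)!(c+d−f−z2)!(b+d+k+1−z2)!)] · [(b+e−a+z3)!(e−f+g+z3)! / (z3!(a+b−e−z3)!(f+g−e−z3)!(2e+1+z3)!)] · [(a+d−e+k−z2−z3)! / ((a−d+f−h+z1+z2)!(e−f−h+k+z1+z3)!)] and S_D = Σ_{z1,z2,z3} (−1)^(z1+z2+z3) · [(2h−z1)!(g−h+k+z1)! / (z1!(a−c+h−z1)!(g+h−k−z1)!(a+c+h+1−z1)!)] · [(2b−z2)!(b−c+f+k−z2)!(b+c+f+k+1−z2)! / (z2!(b−d+k−z2)!(b+d+k+1−z2)!)] · [(2e−z3)!(a+b−e+z3)! / (z3!(e+f−g−z3)!(b−a+e−z3)!(e+f+g+1−z3)!)] · [(e+f+h−k−z1−z3)! / ((b+f−h+k−a+z1−z2)!(a+b−e−z2+z3)!)]. Then, under the triangle conditions of the 9j symbol, (−1)^(c+h−a) ·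 N(a,b,e) · S_A = (−1)^(b−a+f−g) · N(a,c,h) · S_D (both exponents are integers). This expresses the equality of the Ališauskas–Jucys triple-sum formula for the SU(2) 9j coefficient {a b e; c d f; h k g} and the new triple-sum formula obtained from expansion (trsd) of the paper. -/

import Mathlib

noncomputable section

/-- Factorial of a rational argument: `x!` when `x` is a nonnegative integer,
and `0` otherwise.  Terms of a sum containing a factorial with an invalid
argument are thereby omitted: in the numerator such a factor is `0`, and in the
denominator it produces a division by zero, which is `0` in `ℚ`. -/
def fct (x : ℚ) : ℚ :=
  if 0 ≤ x ∧ x.den = 1 then (Nat.factorial x.num.toNat : ℚ) else 0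

/-- `(-1)` raised to a rational exponent (an integer whenever it matters). -/
def neg1pw (x : ℚ) : ℚ := (-1 : ℚ) ^ x.num

/-- `x` is a nonnegative half-integer. -/
def IsNNHalfInt (x : ℚ) : Prop := 0 ≤ x ∧ ∃ m : ℤ, 2 * x = (m : ℚ)

/-- The triangle condition for the triad `(x, y, z)`: the linear combinations
`x+y-z`, `x-y+z` and `-x+y+z` are all nonnegative integers. -/
def Triad (x y z : ℚ) : Prop :=
  (∃ n : ℕ, x + y - z = (n : ℚ)) ∧ (∃ n : ℕ, x - y + z = (n : ℚ)) ∧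
    (∃ n : ℕ, -x + y + z = (n : ℚ))

/-- The square `N(x,y,z)` of the asymmetric triangle coefficient `∇[xyz]`. -/
def Nsq (x y z : ℚ) : ℚ :=
  fct (x + y - z) * fct (x - y + z) * fct (x + y + z + 1) / fct (y + z - x)

/-- The Ališauskas–Jucys triple sum `S_A` for the 9j coefficient. -/
def sumSA (a b c d e f g h k : ℚ) : ℚ :=
  ∑ᶠ z1 : ℕ, ∑ᶠ z2 : ℕ, ∑ᶠ z3 : ℕ,
    (-1 : ℚ) ^ (z1 + z2 + z3) *
      (fct (g - h + k + z1) * fct (a + c - h + z1) * fct (2 * h - z1) /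
        ((Nat.factorial z1 : ℚ) * fct (g + h - k - z1) * fct (c - a + h - z1))) *
      (fct (2 * d - z2) * fct (c - d + f + z2) /
        ((Nat.factorial z2 : ℚ) * fct (d - b + k - z2) * fct (c + d - f - z2) *
          fct (b + d + k + 1 - z2))) *
      (fct (b + e - a + z3) * fct (e - f + g + z3) /
        ((Nat.factorial z3 : ℚ) * fct (a + b - e - z3) * fct (f + g - e - z3) *
          fct (2 * e + 1 + z3))) *
      (fct (a + d - e + k - z2 - z3) /
        (fct (a - d + f - h + z1 + z2) * fct (e - f - h + k + z1 + z3)))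

/-- The triple sum `S_D` of the new triple-sum formula obtained from expansion
(trsd) of the paper. -/
def sumSD (a b c d e f g h k : ℚ) : ℚ :=
  ∑ᶠ z1 : ℕ, ∑ᶠ z2 : ℕ, ∑ᶠ z3 : ℕ,
    (-1 : ℚ) ^ (z1 + z2 + z3) *
      (fct (2 * h - z1) * fct (g - h + k + z1) /
        ((Nat.factorial z1 : ℚ) * fct (a - c + h - z1) * fct (g + h - k - z1) *
          fct (a + c + h + 1 - z1))) *
      (fct (2 * b - z2) * fct (b - c + f + k - z2) * fct (b + c + f + k + 1 - z2) /
        ((Nat.factorial z2 : ℚ) * fct (b - d + k - z2) * fct (b + d + k + 1 - z2))) *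
      (fct (2 * e - z3) * fct (a + b - e + z3) /
        ((Nat.factorial z3 : ℚ) * fct (e + f - g - z3) * fct (b - a + e - z3) *
          fct (e + f + g + 1 - z3))) *
      (fct (e + f + h - k - z1 - z3) /
        (fct (b + f - h + k - a + z1 - z2) * fct (a + b - e - z2 + z3)))

/-- `x` is a natural number. -/
def IsNatural (x : ℚ) : Prop := ∃ n : ℕ, x = n

/-- `x` is an integer. -/
def IsInteger (x : ℚ) : Prop := ∃ n : ℤ, x = n

theorem IsNatural.of_eq {x y : ℚ} (h : IsNatural x) (e : y = x) : IsNatural y := e ▸ h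

theorem IsNatural.nonneg {x : ℚ} (h : IsNatural x) : 0 ≤ x := by
  obtain ⟨n, rfl⟩ := h
  positivity

theorem IsNatural.isInteger {x : ℚ} (h : IsNatural x) : IsInteger x := by
  obtain ⟨n, rfl⟩ := h
  exact ⟨n, by simp⟩

theorem isInteger_natCast (n : ℕ) : IsInteger n := ⟨n, by simp⟩

theorem isInteger_one : IsInteger 1 := ⟨1, by simp⟩

theorem IsInteger.of_eq {x y : ℚ} (h : IsInteger x) (e : y = x) : IsInteger y := e ▸ h

theorem IsInteger.add {x y : ℚ} (hx : IsInteger x) (hy : IsInteger y) : IsInteger (x + y) := by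
  obtain ⟨m, rfl⟩ := hx
  obtain ⟨n, rfl⟩ := hy
  exact ⟨m + n, by simp⟩

theorem IsInteger.sub {x y : ℚ} (hx : IsInteger x) (hy : IsInteger y) : IsInteger (x - y) := by
  obtain ⟨m, rfl⟩ := hx
  obtain ⟨n, rfl⟩ := hy
  exact ⟨m - n, by simp⟩

theorem IsInteger.isNatural {x : ℚ} (hx : IsInteger x) (h : 0 ≤ x) : IsNatural x := by
  obtain ⟨m, rfl⟩ := hx
  lift m to ℕ using by exact_mod_cast h
  exact ⟨m, by simp⟩

theorem IsInteger.le_sub_one {x : ℚ} (hx : IsInteger x) (h : x < 0) : x ≤ -1 := by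
  obtain ⟨m, rfl⟩ := hx
  have hm : m < 0 := by exact_mod_cast h
  exact_mod_cast (by lia : m ≤ -1)

theorem fct_natCast (n : ℕ) : fct n = (n.factorial : ℚ) := by
  simp [fct]

theorem fct_of_neg {x : ℚ} (h : x < 0) : fct x = 0 := by
  simp [fct, not_le.mpr h]

theorem fct_ne_zero {x : ℚ} (h : IsNatural x) : fct x ≠ 0 := by
  obtain ⟨n, rfl⟩ := h
  rw [fct_natCast]
  exact_mod_cast n.factorial_ne_zero

/-- The rising factorial `x (x + 1) ⋯ (x + n - 1)`. -/
def poch (x : ℚ) (n : ℕ) : ℚ := ∏ i ∈ Finset.range n, (x + i)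

theorem poch_zero (x : ℚ) : poch x 0 = 1 := by simp [poch]

theorem poch_succ (x : ℚ) (n : ℕ) : poch x (n + 1) = poch x n * (x + n) := by
  simp [poch, Finset.prod_range_succ]

theorem poch_succ_left (x : ℚ) (n : ℕ) : poch x (n + 1) = x * poch (x + 1) n := by
  simp only [poch, Finset.prod_range_succ', Nat.cast_zero, add_zero, Nat.cast_add, Nat.cast_one]
  rw [mul_comm]
  congr 1
  exact Finset.prod_congr rfl fun i _ => by ring

theorem poch_add (x : ℚ) (m n : ℕ) : poch x (m + n) = poch x m * poch (x + m) n := by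
  induction n with
  | zero => simp [poch_zero]
  | succ n ih =>
    rw [← add_assoc, poch_succ, ih, poch_succ]
    push_cast
    ring

theorem poch_reflect (x : ℚ) (n : ℕ) : poch (-x) n = (-1) ^ n * poch (x - n + 1) n := by
  induction n generalizing x with
  | zero => simp [poch_zero]
  | succ n ih =>
    rw [poch_succ_left, show -x + 1 = -(x - 1) by ring, ih, poch_succ, pow_succ,
      show x - 1 - n + 1 = x - ↑(n + 1) + 1 by push_cast; ring]
    push_cast
    ring

theorem poch_eq_zero {x : ℚ} {n : ℕ} (hx : IsInteger x) (h0 : x ≤ 0) (hn : 0 < x + n) :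
    poch x n = 0 := by
  obtain ⟨m, rfl⟩ := hx
  have h0' : m ≤ 0 := by exact_mod_cast h0
  have hn' : 0 < m + n := by exact_mod_cast hn
  refine Finset.prod_eq_zero (i := (-m).toNat) (Finset.mem_range.mpr (by lia)) ?_
  have : (((-m).toNat : ℤ) : ℚ) = -m := by
    rw [Int.toNat_of_nonneg (by lia)]
    simp
  rw [Int.cast_natCast] at this
  rw [this]
  ring

theorem fct_add_natCast {M : ℚ} (hM : IsNatural M) (z : ℕ) :
    fct (M + z) = fct M * poch (M + 1) z := by
  obtain ⟨m, rfl⟩ := hM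
  induction z with
  | zero => simp [poch_zero]
  | succ z ih =>
    rw [poch_succ, ← mul_assoc, ← ih, ← Nat.cast_add, ← Nat.cast_add, ← add_assoc, fct_natCast,
      fct_natCast, Nat.factorial_succ]
    push_cast
    ring

theorem fct_sub_natCast {M K : ℚ} {n z : ℕ} (hK : IsNatural K) (h : M = K + n) (hz : z ≤ n) :
    fct (M - z) = fct K * poch (K + 1) (n - z) := by
  rw [← fct_add_natCast hK, h, Nat.cast_sub hz]
  congr 1
  ring

theorem neg_one_pow_sub {n z : ℕ} (hz : z ≤ n) :
    (-1 : ℚ) ^ (n - z) = (-1) ^ n * (-1) ^ z := by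
  obtain ⟨m, rfl⟩ := Nat.exists_eq_add_of_le hz
  rcases neg_one_pow_eq_or ℚ z with h | h <;> simp [pow_add, h]

theorem fct_sub_natCast' {M K : ℚ} {n z : ℕ} (hK : IsNatural K) (h : M = K + n) (hz : z ≤ n) :
    fct (M - z) = fct K * ((-1) ^ n * (-1) ^ z * poch (-M + z) (n - z)) := by
  rw [fct_sub_natCast hK h hz, show -M + z = -(M - z) by ring, poch_reflect, neg_one_pow_sub hz,
    h, Nat.cast_sub hz, show K + n - z - (n - z) + 1 = K + 1 by ring]
  rcases neg_one_pow_eq_or ℚ z with h | h <;> rcases neg_one_pow_eq_or ℚ n with h' | h' <;>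
    simp [h, h']

theorem inv_fct_sub {M : ℚ} (hM : IsNatural M) (z : ℕ) :
    (fct (M - z))⁻¹ = (fct M)⁻¹ * ((-1) ^ z * poch (-M) z) := by
  rcases le_or_gt (z : ℚ) M with hz | hz
  · have hN : IsNatural (M - z) :=
      (hM.isInteger.sub (isInteger_natCast z)).isNatural (by linarith)
    have h := fct_add_natCast hN z
    rw [sub_add_cancel] at h
    have h0 := fct_ne_zero hN
    have h1 := fct_ne_zero hM
    rw [poch_reflect, h]
    have h2 : poch (M - z + 1) z ≠ 0 := fun h' => h1 (by rw [h, h', mul_zero])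
    rcases neg_one_pow_eq_or ℚ z with h | h <;> rw [h] <;> field_simp
  · rw [fct_of_neg (by linarith), poch_eq_zero (x := -M)]
    · simp
    · simpa using (isInteger_natCast 0).sub hM.isInteger
    · linarith [hM.nonneg]
    · linarith

theorem inv_fct_add {E K : ℚ} {n z : ℕ} (hK : IsInteger K) (h : K = E + n) (hz : z ≤ n) :
    (fct (E + z))⁻¹ = (fct K)⁻¹ * poch (E + 1 + z) (n - z) := by
  have hKE : K = E + z + ↑(n - z) := by rw [h, Nat.cast_sub hz]; ring
  have hE : IsInteger (E + z) := by
    have := hK.sub (isInteger_natCast (n - z))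
    rwa [hKE, add_sub_cancel_right] at this
  rcases lt_or_ge (E + z) 0 with h0 | h0
  · rw [fct_of_neg h0, inv_zero]
    rcases lt_or_ge K 0 with hk | hk
    · rw [fct_of_neg hk, inv_zero, zero_mul]
    · rw [poch_eq_zero, mul_zero]
      · have := hE.add isInteger_one
        rwa [show E + z + 1 = E + 1 + z by ring] at this
      · linarith [hE.le_sub_one h0]
      · linarith
  · have hN := hE.isNatural h0
    have hk := fct_add_natCast hN (n - z)
    have h1 := fct_ne_zero hN
    have h2 : fct K ≠ 0 := fct_ne_zero (hK.isNatural (by rw [hKE]; positivity))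
    rw [← hKE, show E + z + 1 = E + 1 + z by ring] at hk
    have h3 : poch (E + 1 + z) (n - z) ≠ 0 := fun h' => h2 (by rw [hk, h', mul_zero])
    rw [hk]
    field_simp

theorem fct_natural_sub {N : ℚ} {n z : ℕ} (h : N = n) (hz : z ≤ n) :
    fct (N - z) = ((n - z).factorial : ℚ) := by
  rw [h, ← Nat.cast_sub hz, fct_natCast]

/-- The Pfaff–Saalschütz summation, with denominators cleared. -/
theorem saalschutz_choose (m : ℕ) (A B C : ℚ) :
    ∑ w ∈ Finset.range (m + 1), (m.choose w : ℚ) * (poch A w * poch B w *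
      poch (C + w) (m - w) * poch (C - A - B) (m - w)) = poch (C - A) m * poch (C - B) m := by
  induction m with
  | zero => simp [poch_zero]
  | succ m ih =>
    have key : ∀ k ≤ m + 1, ∑ w ∈ Finset.range k, (m.choose w : ℚ) *
        (poch A (w + 1) * poch B (w + 1) * poch (C + w + 1) (m - w) * poch (C - A - B) (m - w) -
          (A * B + w * (C + m)) *
            (poch A w * poch B w * poch (C + w) (m - w) * poch (C - A - B) (m - w))) =
        k * (m.choose k : ℚ) * (poch A k * poch B k * poch (C + k) (m - k) *
          poch (C - A - B) (m - k)) * (C - A - B + m - k) := by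
      intro k
      induction k with
      | zero => simp
      | succ k ihk =>
        intro hk
        rw [Finset.sum_range_succ, ihk (by lia)]
        rcases Nat.lt_or_ge k m with h | h
        · obtain ⟨r, rfl⟩ := Nat.exists_eq_add_of_lt h
          have hc : ((k + r + 1).choose (k + 1) : ℚ) * (k + 1) =
              (k + r + 1).choose k * (r + 1) := by
            have := Nat.choose_succ_right_eq (k + r + 1) k
            rw [show k + r + 1 - k = r + 1 by lia] at this
            exact_mod_cast this
          have h1 : k + r + 1 - k = r + 1 := by lia
          have h2 : k + r + 1 - (k + 1) = r := by lia
          rw [h1, h2, poch_succ_left (C + k), poch_succ (C + k + 1), poch_succ (C - A - B),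
            poch_succ A, poch_succ B]
          push_cast
          rw [← add_assoc C (k : ℚ) 1]
          linear_combination (-(C - A - B + r) * poch A k * (A + k) * (poch B k * (B + k)) *
            poch (C + k + 1) r * poch (C - A - B) r) * hc
        · obtain rfl : k = m := by lia
          simp only [Nat.sub_self, poch_zero, poch_succ, Nat.choose_succ_self, Nat.choose_self]
          push_cast
          ring
    have h0 := key (m + 1) le_rfl
    rw [Nat.choose_succ_self] at h0
    rw [Finset.sum_range_succ']
    have hsplit : ∀ w ∈ Finset.range (m + 1), ((m + 1).choose (w + 1) : ℚ) *
        (poch A (w + 1) * poch B (w + 1) * poch (C + ↑(w + 1)) (m + 1 - (w + 1)) *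
          poch (C - A - B) (m + 1 - (w + 1))) =
        (m.choose w : ℚ) * (poch A (w + 1) * poch B (w + 1) * poch (C + w + 1) (m - w) *
          poch (C - A - B) (m - w)) +
        (m.choose (w + 1) : ℚ) * (poch A (w + 1) * poch B (w + 1) *
          poch (C + ↑(w + 1)) (m + 1 - (w + 1)) * poch (C - A - B) (m + 1 - (w + 1))) := by
      intro w _
      rw [Nat.choose_succ_succ, Nat.add_sub_add_right]
      push_cast
      rw [← add_assoc C (w : ℚ) 1]
      ring
    rw [Finset.sum_congr rfl hsplit, Finset.sum_add_distrib, add_assoc]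
    have hback := Finset.sum_range_succ' (fun w => (m.choose w : ℚ) * (poch A w * poch B w *
      poch (C + w) (m + 1 - w) * poch (C - A - B) (m + 1 - w))) (m + 1)
    simp only [Nat.choose_zero_right] at hback ⊢
    rw [← hback, Finset.sum_range_succ _ (m + 1), Nat.choose_succ_self]
    have hstep : ∀ w ∈ Finset.range (m + 1), (m.choose w : ℚ) * (poch A w * poch B w *
        poch (C + w) (m + 1 - w) * poch (C - A - B) (m + 1 - w)) =
        ((C + m) * (C - A - B + m - w)) * ((m.choose w : ℚ) * (poch A w * poch B w *
        poch (C + w) (m - w) * poch (C - A - B) (m - w))) := by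
      intro w hw
      rw [Finset.mem_range] at hw
      obtain ⟨r, rfl⟩ := Nat.exists_eq_add_of_le (Nat.lt_succ_iff.mp hw)
      rw [show w + r + 1 - w = r + 1 by lia, show w + r - w = r by lia, poch_succ, poch_succ]
      push_cast
      ring
    rw [Finset.sum_congr rfl hstep, poch_succ (C - A), poch_succ (C - B),
      show poch (C - A) m * (C - A + m) * (poch (C - B) m * (C - B + m)) =
        ((C - A + m) * (C - B + m)) * (poch (C - A) m * poch (C - B) m) by ring, ← ih,
      Finset.mul_sum, Nat.cast_zero, zero_mul, add_zero, ← Finset.sum_add_distrib, ← sub_eq_zero,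
      ← Finset.sum_sub_distrib]
    rw [Nat.cast_zero, mul_zero, zero_mul, zero_mul] at h0
    rw [← h0]
    exact Finset.sum_congr rfl fun w _ => by ring

theorem saalschutz (m : ℕ) (A B C : ℚ) :
    ∑ w ∈ Finset.range (m + 1), ((w.factorial : ℚ)⁻¹ * ((m - w).factorial : ℚ)⁻¹) *
      (poch A w * poch B w * poch (C + w) (m - w) * poch (C - A - B) (m - w)) =
      (m.factorial : ℚ)⁻¹ * (poch (C - A) m * poch (C - B) m) := by
  rw [← saalschutz_choose, Finset.mul_sum]
  refine Finset.sum_congr rfl fun w hw => ?_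
  rw [Nat.cast_choose ℚ (Nat.lt_succ_iff.mp (Finset.mem_range.mp hw))]
  have := m.factorial_ne_zero
  field_simp

theorem saalschutz_alternating (m : ℕ) {A B C D : ℚ} (h : C + D = A + B - m + 1) :
    ∑ w ∈ Finset.range (m + 1), ((w.factorial : ℚ)⁻¹ * ((m - w).factorial : ℚ)⁻¹) * (-1) ^ w *
      (poch A w * poch B w * poch (C + w) (m - w) * poch (D + w) (m - w)) =
      (m.factorial : ℚ)⁻¹ * (poch (C - A) m * poch (D - A) m) := by
  have hD : poch (D - A) m = (-1) ^ m * poch (C - B) m := by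
    rw [show D - A = -(A - D) by ring, poch_reflect, show A - D - m + 1 = C - B by linarith]
  rw [hD, mul_left_comm (poch (C - A) m), mul_left_comm _ ((-1) ^ m), ← saalschutz, Finset.mul_sum]
  refine Finset.sum_congr rfl fun w hw => ?_
  have hw' := Nat.lt_succ_iff.mp (Finset.mem_range.mp hw)
  rw [show D + w = -(-D - w) by ring, poch_reflect, neg_one_pow_sub hw', Nat.cast_sub hw',
    show -D - w - (m - w) + 1 = C - A - B by linarith]
  rcases neg_one_pow_eq_or ℚ w with h | h <;> rw [h] <;> ring

/-- A balanced terminating `₄F₃(-n, a, b, c; d, e, f; 1)`, with denominators cleared. -/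
def whippleLeft (n : ℕ) (a b c d e f : ℚ) : ℚ :=
  ∑ z ∈ Finset.range (n + 1), ((z.factorial : ℚ)⁻¹ * ((n - z).factorial : ℚ)⁻¹) * (-1) ^ z *
    (poch a z * poch b z * poch c z *
      (poch (d + z) (n - z) * poch (e + z) (n - z) * poch (f + z) (n - z)))

/-- The right-hand side of Whipple's transformation, with denominators cleared. -/
def whippleRight (n : ℕ) (a b c d e f : ℚ) : ℚ :=
  ∑ z ∈ Finset.range (n + 1), ((z.factorial : ℚ)⁻¹ * ((n - z).factorial : ℚ)⁻¹) * (-1) ^ z *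
    (poch a z * poch b z * poch c z *
      (poch (d + z) (n - z) * poch e (n - z) * poch f (n - z)))

/-- Whipple's transformation of balanced terminating `₄F₃` series. -/
theorem whipple (n : ℕ) {a b c d e f : ℚ} (h : d + e + f = a + b + c - n + 1) :
    whippleLeft n a b c d e f = whippleRight n a (d - b) (d - c) d (e - a) (f - a) := by
  have hexp : ∀ z ∈ Finset.range (n + 1),
      ((z.factorial : ℚ)⁻¹ * ((n - z).factorial : ℚ)⁻¹) * (-1) ^ z *
        (poch a z * poch b z * poch c z *
          (poch (d + z) (n - z) * poch (e + z) (n - z) * poch (f + z) (n - z))) =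
      ∑ k ∈ Finset.range (z + 1), ((n - z).factorial : ℚ)⁻¹ * (-1) ^ z *
        (poch a z * (poch (d + z) (n - z) * poch (e + z) (n - z) * poch (f + z) (n - z))) *
        (((k.factorial : ℚ)⁻¹ * ((z - k).factorial : ℚ)⁻¹) * (poch (d - b) k * poch (d - c) k *
          poch (d + k) (z - k) * poch (b + c - d) (z - k))) := by
    intro z _
    have hs := saalschutz z (d - b) (d - c) d
    rw [show d - (d - b) - (d - c) = b + c - d by ring, sub_sub_cancel, sub_sub_cancel] at hs
    rw [← Finset.mul_sum, hs]
    ring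
  rw [whippleLeft, whippleRight, Finset.sum_congr rfl hexp,
    Finset.sum_comm' (t' := Finset.range (n + 1)) (s' := fun k => Finset.Ico k (n + 1))
      (by intro x y; simp only [Finset.mem_range, Finset.mem_Ico]; lia)]
  refine Finset.sum_congr rfl fun k hk => ?_
  have hk' := Nat.lt_succ_iff.mp (Finset.mem_range.mp hk)
  obtain ⟨m, rfl⟩ := Nat.exists_eq_add_of_le hk'
  have hs := saalschutz_alternating m (A := a + k) (B := b + c - d) (C := e + k) (D := f + k)
    (by push_cast at h; linarith)
  rw [add_sub_add_right_eq_sub, add_sub_add_right_eq_sub] at hs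
  rw [Finset.sum_Ico_eq_sum_range, show k + m + 1 - k = m + 1 by lia, Nat.add_sub_cancel_left,
    show (k.factorial : ℚ)⁻¹ * (m.factorial : ℚ)⁻¹ * (-1) ^ k * (poch a k * poch (d - b) k *
      poch (d - c) k * (poch (d + k) m * poch (e - a) m * poch (f - a) m)) =
      ((k.factorial : ℚ)⁻¹ * (-1) ^ k * (poch a k * poch (d - b) k * poch (d - c) k *
        poch (d + k) m)) * ((m.factorial : ℚ)⁻¹ * (poch (e - a) m * poch (f - a) m)) by ring,
    ← hs, Finset.mul_sum]
  refine Finset.sum_congr rfl fun w hw => ?_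
  obtain ⟨r, rfl⟩ := Nat.exists_eq_add_of_le (Nat.lt_succ_iff.mp (Finset.mem_range.mp hw))
  rw [show k + (w + r) - (k + w) = r by lia, Nat.add_sub_cancel_left, Nat.add_sub_cancel_left,
    poch_add a, poch_add (d + k), pow_add]
  push_cast
  rw [← add_assoc, ← add_assoc, ← add_assoc]
  ring

/-- The well-poised summation behind the elimination of the intermediate spin. -/
theorem sum_wellPoised (N t u : ℕ) :
    ∑ j ∈ Finset.range (N + 1), (2 * (j : ℚ) + t + u + 1) * ((t + u + j).factorial : ℚ) *
      ((t + j).factorial : ℚ) / ((j.factorial : ℚ) * ((u + j).factorial : ℚ) *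
        ((N + t + u + 1 + j).factorial : ℚ) * ((N - j).factorial : ℚ)) =
      (t.factorial : ℚ) / ((N.factorial : ℚ) * ((N + u).factorial : ℚ)) := by
  induction N with
  | zero =>
    simp [Nat.factorial_succ]
    field_simp
  | succ N ih =>
    have key : ∀ k ≤ N + 1, ∑ j ∈ Finset.range k,
        (2 * (j : ℚ) + t + u + 1) * ((t + u + j).factorial : ℚ) * ((t + j).factorial : ℚ) *
          (j * (j + t + u + 1) - (N + 1) * (t + 1)) / ((j.factorial : ℚ) *
          ((u + j).factorial : ℚ) * ((N + 1 + t + u + 1 + j).factorial : ℚ) *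
          ((N + 1 - j).factorial : ℚ)) =
        -((t + u + k).factorial : ℚ) * ((t + k).factorial : ℚ) * k * (u + k) /
          ((k.factorial : ℚ) * ((u + k).factorial : ℚ) * ((N + 1 + t + u + k).factorial : ℚ) *
          ((N + 1 - k).factorial : ℚ)) := by
      intro k
      induction k with
      | zero => simp
      | succ k ihk =>
        intro hk
        obtain ⟨r, rfl⟩ := Nat.exists_eq_add_of_le (Nat.succ_le_succ_iff.mp hk)
        rw [Finset.sum_range_succ, ihk (by lia), show k + r + 1 - k = r + 1 by lia,
          show k + r + 1 - (k + 1) = r by lia,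
          show k + r + 1 + t + u + 1 + k = k + r + 1 + t + u + k + 1 by ring,
          show k + r + 1 + t + u + (k + 1) = k + r + 1 + t + u + k + 1 by ring, ← add_assoc,
          ← add_assoc, ← add_assoc]
        simp only [Nat.factorial_succ]
        push_cast
        field_simp
        ring
    have h0 := key (N + 1) le_rfl
    have hN : (0 : ℚ) < N + 1 := by positivity
    have hu : (0 : ℚ) < N + u + 1 := by positivity
    have hsum : ∑ j ∈ Finset.range (N + 1 + 1),
        ((N + 1 : ℚ) * (N + u + 1)) * ((2 * (j : ℚ) + t + u + 1) * ((t + u + j).factorial : ℚ) *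
        ((t + j).factorial : ℚ) / ((j.factorial : ℚ) * ((u + j).factorial : ℚ) *
        ((N + 1 + t + u + 1 + j).factorial : ℚ) * ((N + 1 - j).factorial : ℚ))) =
        (t.factorial : ℚ) / ((N.factorial : ℚ) * ((N + u).factorial : ℚ)) := by
      rw [← ih, Finset.sum_range_succ, ← sub_eq_zero, add_sub_right_comm,
        ← Finset.sum_sub_distrib]
      have hdiff : ∀ j ∈ Finset.range (N + 1),
          ((N + 1 : ℚ) * (N + u + 1)) * ((2 * (j : ℚ) + t + u + 1) *
          ((t + u + j).factorial : ℚ) * ((t + j).factorial : ℚ) / ((j.factorial : ℚ) *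
          ((u + j).factorial : ℚ) * ((N + 1 + t + u + 1 + j).factorial : ℚ) *
          ((N + 1 - j).factorial : ℚ))) - (2 * (j : ℚ) + t + u + 1) *
          ((t + u + j).factorial : ℚ) * ((t + j).factorial : ℚ) / ((j.factorial : ℚ) *
          ((u + j).factorial : ℚ) * ((N + t + u + 1 + j).factorial : ℚ) *
          ((N - j).factorial : ℚ)) =
          (2 * (j : ℚ) + t + u + 1) * ((t + u + j).factorial : ℚ) * ((t + j).factorial : ℚ) *
          (j * (j + t + u + 1) - (N + 1) * (t + 1)) / ((j.factorial : ℚ) *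
          ((u + j).factorial : ℚ) * ((N + 1 + t + u + 1 + j).factorial : ℚ) *
          ((N + 1 - j).factorial : ℚ)) := by
        intro j hj
        obtain ⟨r, rfl⟩ := Nat.exists_eq_add_of_le (Nat.lt_succ_iff.mp (Finset.mem_range.mp hj))
        rw [show j + r + 1 - j = r + 1 by lia, show j + r - j = r by lia,
          show j + r + 1 + t + u + 1 + j = j + r + t + u + 1 + j + 1 by ring]
        simp only [Nat.factorial_succ]
        push_cast
        field_simp
        ring
      rw [Finset.sum_congr rfl hdiff, h0, show N + 1 + t + u + 1 + (N + 1) =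
        N + 1 + t + u + (N + 1) + 1 by ring, Nat.sub_self, Nat.factorial_succ (N + 1 + t + u + _)]
      push_cast
      field_simp
      ring
    rw [← Finset.mul_sum] at hsum
    rw [show N + 1 + u = N + u + 1 by ring, Nat.factorial_succ, Nat.factorial_succ]
    have hne : ((N + 1 : ℚ) * (N + u + 1)) ≠ 0 := by positivity
    rw [← mul_left_cancel_iff_of_pos (by positivity : 0 < ((N + 1 : ℚ) * (N + u + 1))), hsum]
    push_cast
    field_simp

/-- The summation formula eliminating the intermediate spin `x = ε + j`. -/
theorem sum_intermediate {ε p q r : ℚ} {J : ℕ} (hε : ε < 1)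
    (hp : IsInteger (p - ε)) (hq : IsInteger (q - ε)) (hr : IsInteger (r - ε))
    (hpq : IsNatural (p + q)) (hJ : r < ε + J) :
    ∑ j ∈ Finset.range J, (2 * (ε + j) + 1) * (fct (ε + j + p) / fct (ε + j - p)) *
      (fct (ε + j + q) / fct (ε + j - q)) * (fct (r + (ε + j) + 1) * fct (r - (ε + j)))⁻¹ =
      fct (p + q) / (fct (r - p) * fct (r - q)) := by
  wlog hle : q ≤ p generalizing p q
  · rw [add_comm p q, mul_comm (fct (r - p)), ← this hq hp (by rwa [add_comm]) (le_of_not_ge hle)]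
    exact Finset.sum_congr rfl fun j _ => by ring
  have hp0 : 0 ≤ p - ε := by
    by_contra! h
    linarith [hp.le_sub_one h, hpq.nonneg]
  have hx : ∀ j : ℕ, r < ε + j ∨ ε + j < p → (2 * (ε + j) + 1) *
      (fct (ε + j + p) / fct (ε + j - p)) * (fct (ε + j + q) / fct (ε + j - q)) *
      (fct (r + (ε + j) + 1) * fct (r - (ε + j)))⁻¹ = 0 := by
    rintro j (h | h)
    · rw [fct_of_neg (x := r - _) (by linarith)]
      simp
    · rw [fct_of_neg (x := ε + j - p) (by linarith)]
      simp
  rcases lt_or_ge r p with hrp | hrp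
  · rw [fct_of_neg (x := r - p) (by linarith), zero_mul, div_zero]
    refine Finset.sum_eq_zero fun j _ => hx j ?_
    rcases lt_or_ge r (ε + j) with h | h
    · exact Or.inl h
    · exact Or.inr (by linarith)
  · obtain ⟨i, hi⟩ := hp.isNatural hp0
    obtain ⟨N, hN⟩ : IsNatural (r - p) := by
      have := (hr.sub hp).isNatural (by linarith)
      rwa [show r - ε - (p - ε) = r - p by ring] at this
    obtain ⟨u, hu⟩ : IsNatural (p - q) := by
      have := (hp.sub hq).isNatural (by linarith)
      rwa [show p - ε - (q - ε) = p - q by ring] at this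
    obtain ⟨t, ht⟩ := hpq
    have hiJ : i + N + 1 ≤ J := by
      have : (i + N : ℚ) < J := by linarith
      exact_mod_cast this
    obtain ⟨s, rfl⟩ := Nat.exists_eq_add_of_le hiJ
    rw [Finset.sum_range_add, Finset.sum_eq_zero (s := Finset.range s), add_zero, add_assoc,
      Finset.sum_range_add, Finset.sum_eq_zero (s := Finset.range i), zero_add, ht, hN,
      show r - q = ((N + u : ℕ) : ℚ) by push_cast; linarith, fct_natCast, fct_natCast, fct_natCast,
      ← sum_wellPoised]
    · refine Finset.sum_congr rfl fun j hj => ?_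
      have hj' := Nat.lt_succ_iff.mp (Finset.mem_range.mp hj)
      rw [show ε + ↑(i + j) + p = ((t + u + j : ℕ) : ℚ) by push_cast; linarith,
        show ε + ↑(i + j) + q = ((t + j : ℕ) : ℚ) by push_cast; linarith,
        show ε + ↑(i + j) - p = (j : ℚ) by push_cast; linarith,
        show ε + ↑(i + j) - q = ((u + j : ℕ) : ℚ) by push_cast; linarith,
        show r + (ε + ↑(i + j)) + 1 = ((N + t + u + 1 + j : ℕ) : ℚ) by push_cast; linarith,
        show r - (ε + ↑(i + j)) = N - j by push_cast; linarith, fct_natural_sub rfl hj',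
        show 2 * (ε + ↑(i + j)) + 1 = 2 * (j : ℚ) + t + u + 1 by push_cast; linarith]
      simp only [fct_natCast]
      field_simp
    · intro j hj
      have : (j : ℚ) < i := by exact_mod_cast Finset.mem_range.mp hj
      exact hx j (Or.inr (by linarith))
    · intro j _
      refine hx _ (Or.inl ?_)
      push_cast
      have : (0 : ℚ) ≤ j := by positivity
      linarith

theorem finsum_eq_sum_range {F : ℕ → ℚ} {n : ℕ} (h : ∀ z, n < z → F z = 0) :
    ∑ᶠ z, F z = ∑ z ∈ Finset.range (n + 1), F z := by
  refine finsum_eq_finsetSum_of_support_subset _ fun z hz => ?_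
  by_contra hz'
  exact hz (h z (by simpa using hz'))

/-- The `z1`-summand of `sumSA` at intermediate spin `x`. -/
def termF (a c h g k x : ℚ) (z : ℕ) : ℚ :=
  (-1) ^ z * (fct (g - h + k + z) * fct (a + c - h + z) * fct (2 * h - z) /
    ((z.factorial : ℚ) * fct (g + h - k - z) * fct (c - a + h - z))) *
    (fct (a + k - h + x + 1 + z) * fct (a + k - h - x + z))⁻¹

/-- The `z2`-summand of `sumSA` at intermediate spin `x`; up to relabelling, also the `z1`- and
`z3`-summands of `sumSD`. -/
def termG (b d k c f x : ℚ) (z : ℕ) : ℚ :=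
  (-1) ^ z * (fct (2 * d - z) * fct (c - d + f + z) /
    ((z.factorial : ℚ) * fct (d - b + k - z) * fct (c + d - f - z) * fct (b + d + k + 1 - z))) *
    (fct (x + d + k - f - z) / fct (x + f - d - k + z))

/-- The `z3`-summand of `sumSA` at intermediate spin `x`. -/
def termH (a b e f g x : ℚ) (z : ℕ) : ℚ :=
  (-1) ^ z * (fct (b + e - a + z) * fct (e - f + g + z) /
    ((z.factorial : ℚ) * fct (a + b - e - z) * fct (f + g - e - z) * fct (2 * e + 1 + z))) *
    (fct (x + a + f - e - z) / fct (x + e - a - f + z))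

/-- The `z2`-summand of `sumSD` at intermediate spin `x`. -/
def termK (b d k c f x : ℚ) (z : ℕ) : ℚ :=
  (-1) ^ z * (fct (2 * b - z) * fct (b - c + f + k - z) * fct (b + c + f + k + 1 - z) /
    ((z.factorial : ℚ) * fct (b - d + k - z) * fct (b + d + k + 1 - z))) *
    (fct (b + f + x + 1 - z) * fct (b + f - x - z))⁻¹

/-- The summand of Racah's formula for the 6j symbol `{b d k; c x f}`. -/
def racahTerm (b d k c f x : ℚ) (z : ℕ) : ℚ :=
  (-1) ^ z * (fct (b + c + f + k + 1 - z) /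
    ((z.factorial : ℚ) * fct (c + k - x - z) * fct (c + f - d - z) * fct (b + k - d - z) *
      fct (b + f - x - z) * fct (x + d - k - f + z) * fct (x + d - b - c + z)))

/-- The summand of Racah's formula for the 6j symbol `{b d k; c x f}`, in reversed order. -/
def racahTermRev (b d k c f x : ℚ) (z : ℕ) : ℚ :=
  (-1) ^ z * (fct (b + x + f + 1 + z) /
    ((z.factorial : ℚ) * fct (x + f - d - k + z) * fct (b + x - c - d + z) *
      fct (b + f - c - k + z) * fct (c + d - f - z) * fct (d - b + k - z) * fct (c + k - x - z)))

theorem termF_eq_zero {a c h g k x : ℚ} {z : ℕ} (hz : g + h - k < z) :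
    termF a c h g k x z = 0 := by
  rw [termF, fct_of_neg (sub_neg.mpr hz)]
  simp

theorem termG_eq_zero {b d k c f x : ℚ} {z : ℕ} (hz : d - b + k < z) :
    termG b d k c f x z = 0 := by
  rw [termG, fct_of_neg (sub_neg.mpr hz)]
  simp

theorem termG_eq_zero' {b d k c f x : ℚ} {z : ℕ} (hz : c + d - f < z) :
    termG b d k c f x z = 0 := by
  rw [termG, fct_of_neg (x := c + d - f - z) (sub_neg.mpr hz)]
  simp

theorem termH_eq_zero {a b e f g x : ℚ} {z : ℕ} (hz : a + b - e < z) :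
    termH a b e f g x z = 0 := by
  rw [termH, fct_of_neg (sub_neg.mpr hz)]
  simp

theorem termK_eq_zero {b d k c f x : ℚ} {z : ℕ} (hz : b - d + k < z) :
    termK b d k c f x z = 0 := by
  rw [termK, fct_of_neg (sub_neg.mpr hz)]
  simp

theorem finsum_termF {a c h g k x : ℚ} {n : ℕ} (hn : g + h - k = n) (h₁ : IsNatural (g - h + k))
    (h₂ : IsNatural (a + c - h)) (h₃ : IsNatural (h + k - g)) (h₄ : IsNatural (c - a + h))
    (h₅ : IsInteger (a + g + x + 1)) (h₆ : IsInteger (a + g - x)) :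
    ∑ᶠ z, termF a c h g k x z = (-1) ^ n * (fct (g - h + k) * fct (a + c - h) * fct (h + k - g) *
      (fct (c - a + h))⁻¹ * (fct (a + g + x + 1))⁻¹ * (fct (a + g - x))⁻¹) *
      whippleLeft n (g - h + k + 1) (a + c - h + 1) (-(c - a + h)) (-(2 * h))
        (a + k - h + x + 1 + 1) (a + k - h - x + 1) := by
  rw [finsum_eq_sum_range (n := n), whippleLeft, Finset.mul_sum]
  · refine Finset.sum_congr rfl fun z hz => ?_
    have hz' := Nat.lt_succ_iff.mp (Finset.mem_range.mp hz)
    simp only [termF, div_eq_mul_inv, mul_inv]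
    rw [fct_add_natCast h₁, fct_add_natCast h₂,
      fct_sub_natCast' (M := 2 * h) h₃ (by linarith) hz', fct_natural_sub hn hz', inv_fct_sub h₄,
      inv_fct_add (E := a + k - h + x + 1) h₅ (by linarith) hz',
      inv_fct_add (E := a + k - h - x) h₆ (by linarith) hz']
    rcases neg_one_pow_eq_or ℚ z with h | h <;> simp only [h] <;> ring
  · intro z hz
    exact termF_eq_zero (by rw [hn]; exact_mod_cast hz)

theorem finsum_termG {b d k c f x : ℚ} {n : ℕ} (hn : d - b + k = n) (h₁ : IsNatural (b + d - k))
    (h₂ : IsNatural (c - d + f)) (h₃ : IsNatural (c + d - f)) (h₄ : IsNatural (b + d + k + 1))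
    (h₅ : IsNatural (x + b - f)) (h₆ : IsInteger (x + f - b)) :
    ∑ᶠ z, termG b d k c f x z = (fct (b + d - k) * fct (c - d + f) * fct (x + b - f) *
      (fct (c + d - f))⁻¹ * (fct (b + d + k + 1))⁻¹ * (fct (x + f - b))⁻¹) *
      whippleRight n (-(c + d - f)) (-(b + d + k + 1)) (c - d + f + 1) (x + f - d - k + 1)
        (x + b - f + 1) (b + d - k + 1) := by
  rw [finsum_eq_sum_range (n := n), whippleRight, Finset.mul_sum]
  · refine Finset.sum_congr rfl fun z hz => ?_
    have hz' := Nat.lt_succ_iff.mp (Finset.mem_range.mp hz)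
    simp only [termG, div_eq_mul_inv, mul_inv]
    rw [fct_add_natCast h₂, fct_sub_natCast (M := 2 * d) h₁ (by linarith) hz',
      fct_natural_sub hn hz', inv_fct_sub h₃, inv_fct_sub h₄,
      fct_sub_natCast (M := x + d + k - f) h₅ (by linarith) hz',
      inv_fct_add (E := x + f - d - k) h₆ (by linarith) hz']
    rcases neg_one_pow_eq_or ℚ z with h | h <;> simp only [h] <;> ring
  · intro z hz
    exact termG_eq_zero (by rw [hn]; exact_mod_cast hz)

theorem finsum_termG' {c h a g k x : ℚ} {n : ℕ} (hn : g + h - k = n) (h₁ : IsNatural (h + k - g))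
    (h₂ : IsNatural (g - h + k)) (h₃ : IsNatural (h - c + a)) (h₄ : IsNatural (c + h + a + 1))
    (h₅ : IsNatural (x + a - g)) (h₆ : IsInteger (x + g - a)) :
    ∑ᶠ z, termG c h a g k x z = (fct (g - h + k) * fct (h + k - g) * fct (x + a - g) *
      (fct (h - c + a))⁻¹ * (fct (c + h + a + 1))⁻¹ * (fct (x + g - a))⁻¹) *
      whippleRight n (g - h + k + 1) (-(c + h + a + 1)) (-(h - c + a)) (-(2 * h))
        (x + a - g + 1) (a - x - g) := by
  rw [finsum_eq_sum_range (n := n), whippleRight, Finset.mul_sum]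
  · refine Finset.sum_congr rfl fun z hz => ?_
    have hz' := Nat.lt_succ_iff.mp (Finset.mem_range.mp hz)
    simp only [termG, div_eq_mul_inv, mul_inv]
    rw [fct_add_natCast h₂, fct_sub_natCast' (M := 2 * h) h₁ (by linarith) hz',
      fct_natural_sub hn hz', inv_fct_sub h₃, inv_fct_sub h₄,
      fct_sub_natCast (M := x + h + a - k) h₅ (by linarith) hz',
      inv_fct_add (E := x + k - h - a) h₆ (by linarith) hz',
      show x + k - h - a + 1 + z = -(-(x + k - h - a + 1 + z)) by ring,
      poch_reflect (-(x + k - h - a + 1 + z)), neg_one_pow_sub hz', Nat.cast_sub hz', ← hn,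
      show -(x + k - h - a + 1 + z) - (g + h - k - z) + 1 = a - x - g by ring]
    rcases neg_one_pow_eq_or ℚ z with h | h <;> rcases neg_one_pow_eq_or ℚ n with h' | h' <;>
      simp only [h, h'] <;> ring
  · intro z hz
    exact termG_eq_zero' (by rw [hn]; exact_mod_cast hz)

theorem finsum_racahTermRev {b d k c f x : ℚ} {n : ℕ} (hn : d - b + k = n)
    (h₁ : IsNatural (b + x + f + 1)) (h₂ : IsNatural (c + d - f)) (h₃ : IsNatural (c + k - x))
    (h₄ : IsInteger (x + f - b)) (h₅ : IsInteger (x + k - c)) (h₆ : IsInteger (d + f - c)) :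
    ∑ᶠ z, racahTermRev b d k c f x z = (fct (b + x + f + 1) * (fct (c + d - f))⁻¹ *
      (fct (c + k - x))⁻¹ * (fct (x + f - b))⁻¹ * (fct (x + k - c))⁻¹ * (fct (d + f - c))⁻¹) *
      whippleLeft n (-(c + d - f)) (b + x + f + 1 + 1) (-(c + k - x)) (x + f - d - k + 1)
        (b + x - c - d + 1) (b + f - c - k + 1) := by
  rw [finsum_eq_sum_range (n := n), whippleLeft, Finset.mul_sum]
  · refine Finset.sum_congr rfl fun z hz => ?_
    have hz' := Nat.lt_succ_iff.mp (Finset.mem_range.mp hz)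
    simp only [racahTermRev, div_eq_mul_inv, mul_inv]
    rw [fct_add_natCast h₁, fct_natural_sub hn hz', inv_fct_sub h₂, inv_fct_sub h₃,
      inv_fct_add (E := x + f - d - k) h₄ (by linarith) hz',
      inv_fct_add (E := b + x - c - d) h₅ (by linarith) hz',
      inv_fct_add (E := b + f - c - k) h₆ (by linarith) hz']
    rcases neg_one_pow_eq_or ℚ z with h | h <;> simp only [h] <;> ring
  · intro z hz
    rw [racahTermRev, fct_of_neg (x := d - b + k - z) (by rw [hn, sub_neg]; exact_mod_cast hz)]
    simp

theorem finsum_termK {b d k c f x : ℚ} {n : ℕ} (hn : b - d + k = n) (h₁ : IsNatural (b + d - k))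
    (h₂ : IsNatural (d + f - c)) (h₃ : IsNatural (c + d + f + 1)) (h₄ : IsNatural (b + d + k + 1))
    (h₅ : IsNatural (b + f + x + 1)) (h₆ : IsNatural (b + f - x)) :
    ∑ᶠ z, termK b d k c f x z = (-1) ^ n * (fct (b + d - k) * fct (d + f - c) *
      fct (c + d + f + 1) * (fct (b + d + k + 1))⁻¹ * (fct (b + f + x + 1))⁻¹ *
      (fct (b + f - x))⁻¹) *
      whippleRight n (-(b + f - x)) (-(b + f + x + 1)) (-(b + d + k + 1)) (-(b + c + f + k + 1))
        (b + d - k + 1) (d + f - c + 1) := by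
  rw [finsum_eq_sum_range (n := n), whippleRight, Finset.mul_sum]
  · refine Finset.sum_congr rfl fun z hz => ?_
    have hz' := Nat.lt_succ_iff.mp (Finset.mem_range.mp hz)
    simp only [termK, div_eq_mul_inv, mul_inv]
    rw [fct_sub_natCast (M := 2 * b) h₁ (by linarith) hz',
      fct_sub_natCast (M := b - c + f + k) h₂ (by linarith) hz',
      fct_sub_natCast' (M := b + c + f + k + 1) h₃ (by linarith) hz', fct_natural_sub hn hz',
      inv_fct_sub h₄, inv_fct_sub h₅, inv_fct_sub h₆]
    rcases neg_one_pow_eq_or ℚ z with h | h <;> simp only [h] <;> ring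
  · intro z hz
    exact termK_eq_zero (by rw [hn]; exact_mod_cast hz)

theorem finsum_racahTerm {b d k c f x : ℚ} {n : ℕ} (hn : b + k - d = n)
    (h₁ : IsNatural (c + d + f + 1)) (h₂ : IsNatural (c + k - x)) (h₃ : IsNatural (c + f - d))
    (h₄ : IsNatural (b + f - x)) (h₅ : IsInteger (x + b - f)) (h₆ : IsInteger (x + k - c)) :
    ∑ᶠ z, racahTerm b d k c f x z = (-1) ^ n * (fct (c + d + f + 1) * (fct (c + k - x))⁻¹ *
      (fct (c + f - d))⁻¹ * (fct (b + f - x))⁻¹ * (fct (x + b - f))⁻¹ * (fct (x + k - c))⁻¹) *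
      whippleLeft n (-(b + f - x)) (-(c + k - x)) (-(c + f - d)) (-(b + c + f + k + 1))
        (x + d - k - f + 1) (x + d - b - c + 1) := by
  rw [finsum_eq_sum_range (n := n), whippleLeft, Finset.mul_sum]
  · refine Finset.sum_congr rfl fun z hz => ?_
    have hz' := Nat.lt_succ_iff.mp (Finset.mem_range.mp hz)
    simp only [racahTerm, div_eq_mul_inv, mul_inv]
    rw [fct_sub_natCast' (M := b + c + f + k + 1) h₁ (by linarith) hz', fct_natural_sub hn hz',
      inv_fct_sub h₂, inv_fct_sub h₃, inv_fct_sub h₄,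
      inv_fct_add (E := x + d - k - f) h₅ (by linarith) hz',
      inv_fct_add (E := x + d - b - c) h₆ (by linarith) hz']
    rcases neg_one_pow_eq_or ℚ z with h | h <;> simp only [h] <;> ring
  · intro z hz
    rw [racahTerm, fct_of_neg (x := b + k - d - z) (by rw [hn, sub_neg]; exact_mod_cast hz)]
    simp

theorem finsum_racahTerm' {a b e f g x : ℚ} {n : ℕ} (hn : a + b - e = n)
    (h₁ : IsNatural (e + f + g + 1)) (h₂ : IsNatural (b + f - x)) (h₃ : IsNatural (f + g - e))
    (h₄ : IsNatural (a + g - x)) (h₅ : IsInteger (x + b - f)) (h₆ : IsInteger (x + a - g)) :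
    ∑ᶠ z, racahTerm g e f b a x z = (-1) ^ n * (fct (e + f + g + 1) * (fct (b + f - x))⁻¹ *
      (fct (f + g - e))⁻¹ * (fct (a + g - x))⁻¹ * (fct (x + b - f))⁻¹ * (fct (x + a - g))⁻¹) *
      whippleLeft n (-(f + g - e)) (-(b + f - x)) (-(a + g - x)) (x + e - f - a + 1)
        (x + e - g - b + 1) (-(g + b + a + f + 1)) := by
  rw [finsum_eq_sum_range (n := n), whippleLeft, Finset.mul_sum]
  · refine Finset.sum_congr rfl fun z hz => ?_
    have hz' := Nat.lt_succ_iff.mp (Finset.mem_range.mp hz)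
    simp only [racahTerm, div_eq_mul_inv, mul_inv]
    rw [fct_sub_natCast' (M := g + b + a + f + 1) h₁ (by linarith) hz',
      fct_natural_sub (N := b + a - e) (by linarith) hz', inv_fct_sub h₂, add_comm g f,
      add_comm g a, inv_fct_sub h₃, inv_fct_sub h₄,
      inv_fct_add (E := x + e - f - a) h₅ (by linarith) hz',
      inv_fct_add (E := x + e - g - b) h₆ (by linarith) hz']
    rcases neg_one_pow_eq_or ℚ z with h | h <;> simp only [h] <;> ring
  · intro z hz
    have hz' : (n : ℚ) < z := by exact_mod_cast hz
    rw [racahTerm, fct_of_neg (x := b + a - e - z) (by linarith)]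
    simp

theorem finsum_termH {a b e f g x : ℚ} {n : ℕ} (hn : a + b - e = n) (h₁ : IsNatural (b + e - a))
    (h₂ : IsNatural (e - f + g)) (h₃ : IsNatural (f + g - e)) (h₄ : IsNatural (x + f - b))
    (h₅ : IsInteger (x + b - f)) (h₆ : IsInteger (a + b + e + 1)) :
    ∑ᶠ z, termH a b e f g x z = (-1) ^ n * (fct (b + e - a) * fct (e - f + g) * fct (x + f - b) *
      (fct (f + g - e))⁻¹ * (fct (x + b - f))⁻¹ * (fct (a + b + e + 1))⁻¹) *
      whippleRight n (-(f + g - e)) (b + e - a + 1) (e - f + g + 1) (x + e - a - f + 1)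
        (x + f - b + 1) (-(a + b + e + 1)) := by
  rw [finsum_eq_sum_range (n := n), whippleRight, Finset.mul_sum]
  · refine Finset.sum_congr rfl fun z hz => ?_
    have hz' := Nat.lt_succ_iff.mp (Finset.mem_range.mp hz)
    simp only [termH, div_eq_mul_inv, mul_inv]
    rw [fct_add_natCast h₁, fct_add_natCast h₂, fct_natural_sub hn hz', inv_fct_sub h₃,
      fct_sub_natCast (M := x + a + f - e) h₄ (by linarith) hz',
      inv_fct_add (E := x + e - a - f) h₅ (by linarith) hz',
      inv_fct_add (E := 2 * e + 1) h₆ (by linarith) hz', poch_reflect (a + b + e + 1),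
      neg_one_pow_sub hz', Nat.cast_sub hz', ← hn,
      show a + b + e + 1 - (a + b - e - z) + 1 = 2 * e + 1 + 1 + z by ring]
    rcases neg_one_pow_eq_or ℚ z with h | h <;> rcases neg_one_pow_eq_or ℚ n with h' | h' <;>
      simp only [h, h'] <;> ring
  · intro z hz
    exact termH_eq_zero (by rw [hn]; exact_mod_cast hz)

theorem finsum_racahTermRev_eq {b d k c f x : ℚ} (h : IsNatural (c + k - x)) :
    ∑ᶠ z, racahTermRev b d k c f x z = neg1pw (c + k - x) * ∑ᶠ z, racahTerm b d k c f x z := by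
  obtain ⟨m, hm⟩ := h
  have hm' : ∀ z : ℕ, m < z → c + k - x - z < 0 := by
    intro z hz
    rw [hm, sub_neg]
    exact_mod_cast hz
  rw [finsum_eq_sum_range (n := m), finsum_eq_sum_range (n := m), ← Finset.sum_range_reflect,
    Finset.mul_sum]
  · refine Finset.sum_congr rfl fun z hz => ?_
    have hz' := Nat.lt_succ_iff.mp (Finset.mem_range.mp hz)
    have hx : x = c + k - m := by linarith
    rw [show m + 1 - 1 - z = m - z by lia, racahTermRev, racahTerm, neg_one_pow_sub hz',
      fct_natural_sub hm hz', hm, neg1pw, Nat.cast_sub hz', hx,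
      sub_sub_cancel (m : ℚ), fct_natCast]
    simp only [Rat.num_natCast, zpow_natCast]
    ring_nf
  · intro z hz
    rw [racahTerm, fct_of_neg (hm' z hz)]
    simp
  · intro z hz
    rw [racahTermRev, fct_of_neg (hm' z hz)]
    simp

theorem Triad.isNatural₁ {x y z : ℚ} (t : Triad x y z) : IsNatural (x + y - z) := t.1

theorem Triad.isNatural₂ {x y z : ℚ} (t : Triad x y z) : IsNatural (x - y + z) := t.2.1

theorem Triad.isNatural₃ {x y z : ℚ} (t : Triad x y z) : IsNatural (-x + y + z) := t.2.2

theorem Triad.isNatural_sum_add_one {x y z : ℚ} (t : Triad x y z) : IsNatural (x + y + z + 1) := by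
  obtain ⟨⟨l, hl⟩, ⟨m, hm⟩, n, hn⟩ := t
  exact ⟨l + m + n + 1, by push_cast; linarith⟩

theorem Nsq_mul_finsum_termF {a c h g k x : ℚ} (t₃ : Triad h k g) (t₄ : Triad a c h)
    (ta : Triad a g x) :
    Nsq a g x * ∑ᶠ z, termF a c h g k x z =
      neg1pw (g + h - k) * Nsq a c h * ∑ᶠ z, termG c h a g k x z := by
  obtain ⟨n, hn⟩ : IsNatural (g + h - k) := t₃.isNatural₂.of_eq (by ring)
  have h₁ : IsNatural (g - h + k) := t₃.isNatural₃.of_eq (by ring)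
  have h₄ : IsNatural (c - a + h) := t₄.isNatural₃.of_eq (by ring)
  have h₅ : IsNatural (h - c + a) := t₄.isNatural₂.of_eq (by ring)
  have h₆ : IsNatural (c + h + a + 1) := t₄.isNatural_sum_add_one.of_eq (by ring)
  have h₇ : IsNatural (x + a - g) := ta.isNatural₂.of_eq (by ring)
  have h₈ : IsNatural (x + g - a) := ta.isNatural₃.of_eq (by ring)
  have hW : whippleLeft n (g - h + k + 1) (a + c - h + 1) (-(c - a + h)) (-(2 * h))
      (a + k - h + x + 1 + 1) (a + k - h - x + 1) =
      whippleRight n (g - h + k + 1) (-(c + h + a + 1)) (-(h - c + a)) (-(2 * h))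
        (x + a - g + 1) (a - x - g) := by
    rw [whipple n (by rw [← hn]; ring)]
    congr 1 <;> ring
  rw [finsum_termF hn h₁ t₄.isNatural₁ t₃.isNatural₁ h₄ ta.isNatural_sum_add_one.isInteger
      ta.isNatural₁.isInteger,
    finsum_termG' hn t₃.isNatural₁ h₁ h₅ h₆ h₇ h₈.isInteger, hn, neg1pw, Rat.num_natCast,
    zpow_natCast, hW,
    Nsq, Nsq, show a - g + x = x + a - g by ring, show g + x - a = x + g - a by ring,
    show a - c + h = h - c + a by ring, show a + c + h + 1 = c + h + a + 1 by ring,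
    show c + h - a = c - a + h by ring]
  have := fct_ne_zero h₅
  have := fct_ne_zero h₆
  have := fct_ne_zero ta.isNatural₁
  have := fct_ne_zero ta.isNatural_sum_add_one
  field_simp

theorem finsum_termG_eq_racahTerm {b d k c f x : ℚ} (t₅ : Triad b d k) (t₂ : Triad c d f)
    (tb : Triad b f x) (tc : Triad c k x) :
    ∑ᶠ z, termG b d k c f x z = fct (b + d - k) * fct (c + f - d) * fct (d + f - c) /
      fct (b + d + k + 1) * (fct (x + b - f) * fct (c + k - x) * fct (x + k - c) /
      fct (b + x + f + 1)) * (neg1pw (c + k - x) * ∑ᶠ z, racahTerm b d k c f x z) := by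
  obtain ⟨n, hn⟩ : IsNatural (d - b + k) := t₅.isNatural₃.of_eq (by ring)
  have h₂ : IsNatural (c + f - d) := t₂.isNatural₂.of_eq (by ring)
  have h₃ : IsNatural (d + f - c) := t₂.isNatural₃.of_eq (by ring)
  have h₅ : IsNatural (x + b - f) := tb.isNatural₂.of_eq (by ring)
  have h₆ : IsNatural (x + f - b) := tb.isNatural₃.of_eq (by ring)
  have h₇ : IsNatural (b + x + f + 1) := tb.isNatural_sum_add_one.of_eq (by ring)
  have h₈ : IsNatural (x + k - c) := tc.isNatural₃.of_eq (by ring)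
  have hW : whippleLeft n (-(c + d - f)) (b + x + f + 1 + 1) (-(c + k - x)) (x + f - d - k + 1)
        (b + x - c - d + 1) (b + f - c - k + 1) =
      whippleRight n (-(c + d - f)) (-(b + d + k + 1)) (c + f - d + 1) (x + f - d - k + 1)
        (x + b - f + 1) (b + d - k + 1) := by
    rw [whipple n (by rw [← hn]; ring)]
    congr 1 <;> ring
  rw [finsum_termG hn t₅.isNatural₁ (h₂.of_eq (by ring)) t₂.isNatural₁ t₅.isNatural_sum_add_one h₅
      h₆.isInteger,
    ← finsum_racahTermRev_eq tc.isNatural₁,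
    finsum_racahTermRev hn h₇ t₂.isNatural₁ tc.isNatural₁ h₆.isInteger h₈.isInteger
      h₃.isInteger, show c - d + f = c + f - d by ring, hW]
  have := fct_ne_zero h₃
  have := fct_ne_zero h₇
  have := fct_ne_zero h₈
  have := fct_ne_zero tc.isNatural₁
  field_simp

theorem finsum_termK_eq_racahTerm {b d k c f x : ℚ} (t₅ : Triad b d k) (t₂ : Triad c d f)
    (tb : Triad b f x) (tc : Triad c k x) :
    ∑ᶠ z, termK b d k c f x z = fct (b + d - k) * fct (c + f - d) * fct (d + f - c) /
      fct (b + d + k + 1) * (fct (x + b - f) * fct (c + k - x) * fct (x + k - c) /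
      fct (b + x + f + 1)) * ∑ᶠ z, racahTerm b d k c f x z := by
  obtain ⟨n, hn⟩ : IsNatural (b - d + k) := t₅.isNatural₂
  have h₁ : IsNatural (c + d + f + 1) := t₂.isNatural_sum_add_one
  have h₂ : IsNatural (c + f - d) := t₂.isNatural₂.of_eq (by ring)
  have h₃ : IsNatural (d + f - c) := t₂.isNatural₃.of_eq (by ring)
  have h₅ : IsNatural (x + b - f) := tb.isNatural₂.of_eq (by ring)
  have h₈ : IsNatural (x + k - c) := tc.isNatural₃.of_eq (by ring)
  have hW : whippleLeft n (-(b + f - x)) (-(c + k - x)) (-(c + f - d)) (-(b + c + f + k + 1))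
        (x + d - k - f + 1) (x + d - b - c + 1) =
      whippleRight n (-(b + f - x)) (-(b + f + x + 1)) (-(b + d + k + 1)) (-(b + c + f + k + 1))
        (b + d - k + 1) (d + f - c + 1) := by
    rw [whipple n (by rw [← hn]; ring)]
    congr 1 <;> ring
  rw [finsum_termK hn t₅.isNatural₁ h₃ h₁ t₅.isNatural_sum_add_one tb.isNatural_sum_add_one
      tb.isNatural₁,
    finsum_racahTerm (by rw [← hn]; ring) h₁ tc.isNatural₁ h₂ tb.isNatural₁ h₅.isInteger
      h₈.isInteger, hW,
    show b + x + f + 1 = b + f + x + 1 by ring]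
  have := fct_ne_zero h₂
  have := fct_ne_zero h₅
  have := fct_ne_zero h₈
  have := fct_ne_zero tc.isNatural₁
  field_simp

theorem finsum_termG_eq_finsum_termK {b d k c f x : ℚ} (t₅ : Triad b d k) (t₂ : Triad c d f)
    (tb : Triad b f x) (tc : Triad c k x) :
    ∑ᶠ z, termG b d k c f x z = neg1pw (c + k - x) * ∑ᶠ z, termK b d k c f x z := by
  rw [finsum_termG_eq_racahTerm t₅ t₂ tb tc, finsum_termK_eq_racahTerm t₅ t₂ tb tc]
  ring

theorem Nsq_mul_finsum_termH {a b e f g x : ℚ} (t₁ : Triad a b e) (t₆ : Triad e f g)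
    (ta : Triad a g x) (tb : Triad b f x) :
    Nsq a b e * ∑ᶠ z, termH a b e f g x z =
      neg1pw (b + f - x) * Nsq a g x * ∑ᶠ z, termG g e f b a x z := by
  obtain ⟨n, hn⟩ : IsNatural (a + b - e) := t₁.isNatural₁
  have h₁ : IsNatural (b + e - a) := t₁.isNatural₃.of_eq (by ring)
  have h₂ : IsNatural (f + g - e) := t₆.isNatural₃.of_eq (by ring)
  have h₃ : IsNatural (x + b - f) := tb.isNatural₂.of_eq (by ring)
  have h₄ : IsNatural (x + f - b) := tb.isNatural₃.of_eq (by ring)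
  have h₅ : IsNatural (x + a - g) := ta.isNatural₂.of_eq (by ring)
  have h₆ : IsNatural (g + x - a) := ta.isNatural₃.of_eq (by ring)
  have hW : whippleLeft n (-(f + g - e)) (-(b + f - x)) (-(a + g - x)) (x + e - f - a + 1)
        (x + e - g - b + 1) (-(g + b + a + f + 1)) =
      whippleRight n (-(f + g - e)) (b + e - a + 1) (e - f + g + 1) (x + e - a - f + 1)
        (x + f - b + 1) (-(a + b + e + 1)) := by
    rw [whipple n (by rw [← hn]; ring)]
    congr 1 <;> ring
  rw [finsum_termG_eq_racahTerm ⟨t₆.isNatural₂.of_eq (by ring), t₆.isNatural₃.of_eq (by ring),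
      t₆.isNatural₁.of_eq (by ring)⟩ ⟨t₁.isNatural₃.of_eq (by ring), t₁.isNatural₁.of_eq (by ring),
      t₁.isNatural₂.of_eq (by ring)⟩
      ⟨ta.isNatural₁.of_eq (by ring), ta.isNatural₃.of_eq (by ring), ta.isNatural₂.of_eq (by ring)⟩
        tb,
    finsum_termH hn h₁ t₆.isNatural₂ h₂ h₄ h₃.isInteger t₁.isNatural_sum_add_one.isInteger,
    finsum_racahTerm' hn t₆.isNatural_sum_add_one tb.isNatural₁ h₂ ta.isNatural₁ h₃.isInteger
      h₅.isInteger, hW,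
    Nsq, Nsq, show g + e - f = e - f + g by ring, show b + a - e = a + b - e by ring,
    show e + a - b = a - b + e by ring, show g + e + f + 1 = e + f + g + 1 by ring,
    show x + g - a = g + x - a by ring, show g + x + a + 1 = a + g + x + 1 by ring,
    show a - g + x = x + a - g by ring]
  have := fct_ne_zero h₁
  have := fct_ne_zero h₅
  have := fct_ne_zero h₆
  have := fct_ne_zero ta.isNatural₁
  have := fct_ne_zero tb.isNatural₁
  have := fct_ne_zero ta.isNatural_sum_add_one
  have := fct_ne_zero t₁.isNatural_sum_add_one
  have := fct_ne_zero t₆.isNatural_sum_add_one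
  have hs : neg1pw (b + f - x) ^ 2 = 1 := by
    rw [neg1pw, ← zpow_natCast, zpow_comm, Nat.cast_ofNat, even_two.neg_one_zpow, one_zpow]
  have := fct_ne_zero h₂
  have := fct_ne_zero h₃
  field_simp
  rw [hs, mul_one]

/-- The integrality part of the triangle condition. -/
def IntegralTriad (x y z : ℚ) : Prop :=
  IsInteger (x + y - z) ∧ IsInteger (x - y + z) ∧ IsInteger (-x + y + z)

theorem IntegralTriad.triad {x y z : ℚ} (t : IntegralTriad x y z) (h₁ : z ≤ x + y)
    (h₂ : y - x ≤ z) (h₃ : x - y ≤ z) : Triad x y z :=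
  ⟨t.1.isNatural (by linarith), t.2.1.isNatural (by linarith), t.2.2.isNatural (by linarith)⟩

theorem IntegralTriad.swap {x y z : ℚ} (t : IntegralTriad x y z) : IntegralTriad y x z :=
  ⟨t.1.of_eq (by ring), t.2.2.of_eq (by ring), t.2.1.of_eq (by ring)⟩

theorem IntegralTriad.isInteger_sum_add_one {x y z : ℚ} (t : IntegralTriad x y z) :
    IsInteger (x + y + z + 1) :=
  ((t.1.add (t.2.1.add t.2.2)).add isInteger_one).of_eq (by ring)

theorem finsum_eq_zero_of_forall {F : ℕ → ℚ} (h : ∀ z, F z = 0) : ∑ᶠ z, F z = 0 := by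
  simp [h]

theorem finsum_termF_eq_zero_of_gt {a c h g k x : ℚ} (hx : a + g < x ∨ c + k < x) :
    ∑ᶠ z, termF a c h g k x z = 0 := by
  refine finsum_eq_zero_of_forall fun z => ?_
  rw [termF]
  rcases lt_or_ge (g + h - k) z with h₁ | h₁
  · rw [fct_of_neg (x := g + h - k - z) (by linarith)]
    simp
  rcases lt_or_ge (c - a + h) z with h₂ | h₂
  · rw [fct_of_neg (x := c - a + h - z) (by linarith)]
    simp
  rw [fct_of_neg (x := a + k - h - x + z) (by rcases hx with hx | hx <;> linarith)]
  simp

theorem finsum_termG_eq_zero_of_lt {b d k c f x : ℚ} (hx : x < b - f ∨ x < k - c) :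
    ∑ᶠ z, termG b d k c f x z = 0 := by
  refine finsum_eq_zero_of_forall fun z => ?_
  rw [termG]
  rcases lt_or_ge (d - b + k) z with h₁ | h₁
  · rw [fct_of_neg (x := d - b + k - z) (by linarith)]
    simp
  rcases lt_or_ge (c + d - f) z with h₂ | h₂
  · rw [fct_of_neg (x := c + d - f - z) (by linarith)]
    simp
  rw [fct_of_neg (x := x + f - d - k + z) (by rcases hx with hx | hx <;> linarith)]
  simp

theorem finsum_termH_eq_zero_of_lt {a b e f g x : ℚ} (hx : x < f - b ∨ x < a - g) :
    ∑ᶠ z, termH a b e f g x z = 0 := by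
  refine finsum_eq_zero_of_forall fun z => ?_
  rw [termH]
  rcases lt_or_ge (a + b - e) z with h₁ | h₁
  · rw [fct_of_neg (x := a + b - e - z) (by linarith)]
    simp
  rcases lt_or_ge (f + g - e) z with h₂ | h₂
  · rw [fct_of_neg (x := f + g - e - z) (by linarith)]
    simp
  rw [fct_of_neg (x := x + e - a - f + z) (by rcases hx with hx | hx <;> linarith)]
  simp

theorem finsum_termK_eq_zero_of_gt {b d k c f x : ℚ} (hx : b + f < x) :
    ∑ᶠ z, termK b d k c f x z = 0 := by
  refine finsum_eq_zero_of_forall fun z => ?_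
  rw [termK, fct_of_neg (x := b + f - x - z) (by
    have : (0 : ℚ) ≤ z := by positivity
    linarith)]
  simp

theorem finsum_termF_eq_zero_of_lt {a c h g k x : ℚ} (t₃ : Triad h k g) (t₄ : Triad a c h)
    (ta : IntegralTriad a g x) (hx : x < g - a) (hk : k - c ≤ x) :
    ∑ᶠ z, termF a c h g k x z = 0 := by
  obtain ⟨n, hn⟩ : IsNatural (g + h - k) := t₃.isNatural₂.of_eq (by ring)
  rw [finsum_termF hn (t₃.isNatural₃.of_eq (by ring)) t₄.isNatural₁ t₃.isNatural₁
    (t₄.isNatural₃.of_eq (by ring)) ta.isInteger_sum_add_one ta.1, whipple n (by rw [← hn]; ring),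
    whippleRight, Finset.sum_eq_zero, mul_zero]
  intro z hz
  have hz' := Nat.lt_succ_iff.mp (Finset.mem_range.mp hz)
  rcases lt_or_ge (a - c + h) z with h₁ | h₁
  · rw [poch_eq_zero (x := -(2 * h) - -(c - a + h))]
    · ring
    · exact ((isInteger_natCast 0).sub t₄.isNatural₂.isInteger).of_eq (by push_cast; ring)
    · linarith [t₄.isNatural₂.nonneg]
    · linarith
  · rw [poch_eq_zero (x := a + k - h + x + 1 + 1 - (g - h + k + 1))]
    · ring
    · exact (ta.2.1.add isInteger_one).of_eq (by ring)
    · linarith [ta.2.1.le_sub_one (by linarith)]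
    · rw [Nat.cast_sub hz', ← hn]
      linarith

theorem termF_comm (a c h g k x : ℚ) : termF a c h g k x = termF k g h c a x := by
  funext z
  rw [termF, termF, show g - h + k = k + g - h by ring, show c - h + a = a + c - h by ring,
    show g - k + h = g + h - k by ring, show c + h - a = c - a + h by ring, add_comm a k]
  ring

theorem finsum_termG_eq_zero_of_gt {b d k c f x : ℚ} (t₅ : Triad b d k) (t₂ : Triad c d f)
    (tb : IntegralTriad b f x) (tc : IntegralTriad c k x) (hf : f - b ≤ x) (hc : x ≤ c + k)
    (hx : b + f < x) : ∑ᶠ z, termG b d k c f x z = 0 := by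
  obtain ⟨n, hn⟩ : IsNatural (d - b + k) := t₅.isNatural₃.of_eq (by ring)
  have hW : whippleLeft n (-(c + d - f)) (b + x + f + 1 + 1) (-(c + k - x)) (x + f - d - k + 1)
        (b + x - c - d + 1) (b + f - c - k + 1) =
      whippleRight n (-(c + d - f)) (-(b + d + k + 1)) (c - d + f + 1) (x + f - d - k + 1)
        (x + b - f + 1) (b + d - k + 1) := by
    rw [whipple n (by rw [← hn]; ring)]
    congr 1 <;> ring
  rw [finsum_termG hn t₅.isNatural₁ (t₂.isNatural₂.of_eq (by ring)) t₂.isNatural₁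
    t₅.isNatural_sum_add_one ((tb.2.1.isNatural (by linarith)).of_eq (by ring))
    (tb.2.2.of_eq (by ring)), ← hW, whippleLeft, Finset.sum_eq_zero, mul_zero]
  intro z hz
  have hz' := Nat.lt_succ_iff.mp (Finset.mem_range.mp hz)
  rcases lt_or_ge (c + k - x) z with h₁ | h₁
  · rw [poch_eq_zero (x := -(c + k - x))]
    · ring
    · exact ((isInteger_natCast 0).sub tc.1).of_eq (by push_cast; ring)
    · linarith
    · linarith
  · rw [poch_eq_zero (x := b + f - c - k + 1 + z)]
    · ring
    · exact (((tb.1.sub tc.1).add isInteger_one).add (isInteger_natCast z)).of_eq (by ring)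
    · linarith [tb.1.le_sub_one (by linarith)]
    · rw [Nat.cast_sub hz', ← hn]
      linarith [t₂.isNatural₃.nonneg]

theorem finsum_termK_eq_zero_of_lt {b d k c f x : ℚ} (t₅ : Triad b d k) (t₂ : Triad c d f)
    (tb : IntegralTriad b f x) (tc : IntegralTriad c k x) (hb : x ≤ b + f) (hf : f - b ≤ x)
    (hc : c - k ≤ x) (hx : x < k - c ∨ x < b - f) : ∑ᶠ z, termK b d k c f x z = 0 := by
  obtain ⟨n, hn⟩ : IsNatural (b - d + k) := t₅.isNatural₂
  have hW : whippleLeft n (-(b + f - x)) (-(c + k - x)) (-(c + f - d)) (-(b + c + f + k + 1))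
        (x + d - k - f + 1) (x + d - b - c + 1) =
      whippleRight n (-(b + f - x)) (-(b + f + x + 1)) (-(b + d + k + 1)) (-(b + c + f + k + 1))
        (b + d - k + 1) (d + f - c + 1) := by
    rw [whipple n (by rw [← hn]; ring)]
    congr 1 <;> ring
  rw [finsum_termK hn t₅.isNatural₁ (t₂.isNatural₃.of_eq (by ring)) t₂.isNatural_sum_add_one
    t₅.isNatural_sum_add_one (tb.isInteger_sum_add_one.isNatural (by
      linarith [t₂.isNatural₂.nonneg, t₂.isNatural₃.nonneg])) (tb.1.isNatural (by linarith)), ← hW,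
    whippleLeft, Finset.sum_eq_zero, mul_zero]
  intro z hz
  have hz' := Nat.lt_succ_iff.mp (Finset.mem_range.mp hz)
  rcases lt_or_ge (c + f - d) z with h₁ | h₁
  · rw [poch_eq_zero (x := -(c + f - d))]
    · ring
    · exact ((isInteger_natCast 0).sub t₂.isNatural₂.isInteger).of_eq (by push_cast; ring)
    · linarith [t₂.isNatural₂.nonneg]
    · linarith
  rcases hx with hx | hx
  · rw [poch_eq_zero (x := x + d - k - f + 1 + z)]
    · ring
    · exact (((tc.2.1.sub t₂.isNatural₂.isInteger).add isInteger_one).add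
        (isInteger_natCast z)).of_eq (by ring)
    · linarith [tc.2.1.le_sub_one (by linarith)]
    · rw [Nat.cast_sub hz', ← hn]
      linarith
  · rw [poch_eq_zero (x := x + d - b - c + 1 + z)]
    · ring
    · exact (((tb.2.2.sub t₂.isNatural₂.isInteger).add isInteger_one).add
        (isInteger_natCast z)).of_eq (by ring)
    · linarith [tb.2.2.le_sub_one (by linarith)]
    · rw [Nat.cast_sub hz', ← hn]
      linarith

theorem neg1pw_intCast (m : ℤ) : neg1pw m = (-1) ^ m := by
  simp [neg1pw]

theorem neg1pw_product {a b c f g h k x : ℚ} (h₁ : IsInteger (c + h - a))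
    (h₂ : IsInteger (g + h - k)) (h₃ : IsInteger (c + k - x)) (h₄ : IsInteger (b + f - x))
    (h₅ : IsInteger (a + g - x)) :
    neg1pw (c + h - a) * (neg1pw (g + h - k) * neg1pw (c + k - x) * neg1pw (b + f - x)) =
      neg1pw (b - a + f - g) := by
  obtain ⟨m₁, h₁⟩ := h₁
  obtain ⟨m₂, h₂⟩ := h₂
  obtain ⟨m₃, h₃⟩ := h₃
  obtain ⟨m₄, h₄⟩ := h₄
  obtain ⟨m₅, h₅⟩ := h₅
  have h : b - a + f - g = ((m₁ + (m₂ + m₃ + m₄) - 2 * (m₁ + m₅) : ℤ) : ℚ) := by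
    push_cast
    linarith
  have h0 : (-1 : ℚ) ≠ 0 := by norm_num
  rw [h, h₁, h₂, h₃, h₄]
  simp only [neg1pw_intCast]
  rw [zpow_sub₀ h0, (even_two_mul _).neg_one_zpow, div_one, zpow_add₀ h0, zpow_add₀ h0,
    zpow_add₀ h0]

theorem product_A_eq_product_D {a b c d e f g h k x : ℚ} (t₁ : Triad a b e) (t₂ : Triad c d f)
    (t₃ : Triad h k g) (t₄ : Triad a c h) (t₅ : Triad b d k) (t₆ : Triad e f g)
    (ta : IntegralTriad a g x) (tb : IntegralTriad b f x) (tc : IntegralTriad c k x) :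
    neg1pw (c + h - a) * Nsq a b e * ((∑ᶠ z, termF a c h g k x z) *
      (∑ᶠ z, termG b d k c f x z) * ∑ᶠ z, termH a b e f g x z) =
    neg1pw (b - a + f - g) * Nsq a c h * ((∑ᶠ z, termG c h a g k x z) *
      (∑ᶠ z, termK b d k c f x z) * ∑ᶠ z, termG g e f b a x z) := by
  have u₁ : Triad g e f := ⟨t₆.isNatural₂.of_eq (by ring), t₆.isNatural₃.of_eq (by ring),
    t₆.isNatural₁.of_eq (by ring)⟩
  have u₂ : Triad b e a := ⟨t₁.isNatural₃.of_eq (by ring), t₁.isNatural₁.of_eq (by ring),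
    t₁.isNatural₂.of_eq (by ring)⟩
  have u₃ : Triad c h a := ⟨t₄.isNatural₃.of_eq (by ring), t₄.isNatural₁.of_eq (by ring),
    t₄.isNatural₂.of_eq (by ring)⟩
  have u₄ : Triad g h k := ⟨t₃.isNatural₂.of_eq (by ring), t₃.isNatural₃.of_eq (by ring),
    t₃.isNatural₁.of_eq (by ring)⟩
  have u₅ : Triad k g h := ⟨t₃.isNatural₃.of_eq (by ring), t₃.isNatural₁.of_eq (by ring),
    t₃.isNatural₂.of_eq (by ring)⟩
  have u₆ : Triad h a c := ⟨t₄.isNatural₂.of_eq (by ring), t₄.isNatural₃.of_eq (by ring),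
    t₄.isNatural₁.of_eq (by ring)⟩
  by_cases hx : (g - a ≤ x ∧ a - g ≤ x ∧ x ≤ a + g) ∧ (f - b ≤ x ∧ b - f ≤ x ∧ x ≤ b + f) ∧
    (k - c ≤ x ∧ c - k ≤ x ∧ x ≤ c + k)
  · obtain ⟨⟨ha₁, ha₂, ha₃⟩, ⟨hb₁, hb₂, hb₃⟩, hc₁, hc₂, hc₃⟩ := hx
    have hF := Nsq_mul_finsum_termF t₃ t₄ (ta.triad ha₃ ha₁ ha₂)
    have hG := finsum_termG_eq_finsum_termK t₅ t₂ (tb.triad hb₃ hb₁ hb₂) (tc.triad hc₃ hc₁ hc₂)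
    have hH := Nsq_mul_finsum_termH t₁ t₆ (ta.triad ha₃ ha₁ ha₂) (tb.triad hb₃ hb₁ hb₂)
    rw [← neg1pw_product (t₄.isNatural₃.isInteger.of_eq (by ring)) u₄.isNatural₁.isInteger tc.1 tb.1
      ta.1, hG]
    linear_combination neg1pw (c + h - a) * neg1pw (c + k - x) * (∑ᶠ z, termK b d k c f x z) *
      ((∑ᶠ z, termF a c h g k x z) * hH +
        neg1pw (b + f - x) * (∑ᶠ z, termG g e f b a x z) * hF)
  · have hA : (∑ᶠ z, termF a c h g k x z) * (∑ᶠ z, termG b d k c f x z) *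
        ∑ᶠ z, termH a b e f g x z = 0 := by
      rcases lt_or_ge (c + k) x with hc₃ | hc₃
      · rw [finsum_termF_eq_zero_of_gt (Or.inr hc₃), zero_mul, zero_mul]
      rcases lt_or_ge (a + g) x with ha₃ | ha₃
      · rw [finsum_termF_eq_zero_of_gt (Or.inl ha₃), zero_mul, zero_mul]
      rcases lt_or_ge x (b - f) with hb₂ | hb₂
      · rw [finsum_termG_eq_zero_of_lt (Or.inl hb₂), mul_zero, zero_mul]
      rcases lt_or_ge x (k - c) with hc₁ | hc₁
      · rw [finsum_termG_eq_zero_of_lt (Or.inr hc₁), mul_zero, zero_mul]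
      rcases lt_or_ge x (f - b) with hb₁ | hb₁
      · rw [finsum_termH_eq_zero_of_lt (Or.inl hb₁), mul_zero]
      rcases lt_or_ge x (a - g) with ha₂ | ha₂
      · rw [finsum_termH_eq_zero_of_lt (Or.inr ha₂), mul_zero]
      rcases lt_or_ge x (g - a) with ha₁ | ha₁
      · rw [finsum_termF_eq_zero_of_lt t₃ t₄ ta ha₁ hc₁, zero_mul, zero_mul]
      rcases lt_or_ge x (c - k) with hc₂ | hc₂
      · rw [termF_comm, finsum_termF_eq_zero_of_lt u₆ u₅ tc.swap hc₂ ha₂, zero_mul, zero_mul]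
      rcases lt_or_ge (b + f) x with hb₃ | hb₃
      · rw [finsum_termG_eq_zero_of_gt t₅ t₂ tb tc hb₁ hc₃ hb₃, mul_zero, zero_mul]
      exact absurd ⟨⟨ha₁, ha₂, ha₃⟩, ⟨hb₁, hb₂, hb₃⟩, hc₁, hc₂, hc₃⟩ hx
    have hD : (∑ᶠ z, termG c h a g k x z) * (∑ᶠ z, termK b d k c f x z) *
        ∑ᶠ z, termG g e f b a x z = 0 := by
      rcases lt_or_ge x (c - k) with hc₂ | hc₂
      · rw [finsum_termG_eq_zero_of_lt (Or.inl hc₂), zero_mul, zero_mul]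
      rcases lt_or_ge x (a - g) with ha₂ | ha₂
      · rw [finsum_termG_eq_zero_of_lt (b := c) (Or.inr ha₂), zero_mul, zero_mul]
      rcases lt_or_ge (b + f) x with hb₃ | hb₃
      · rw [finsum_termK_eq_zero_of_gt hb₃, mul_zero, zero_mul]
      rcases lt_or_ge x (g - a) with ha₁ | ha₁
      · rw [finsum_termG_eq_zero_of_lt (b := g) (Or.inl ha₁), mul_zero]
      rcases lt_or_ge x (f - b) with hb₁ | hb₁
      · rw [finsum_termG_eq_zero_of_lt (b := g) (Or.inr hb₁), mul_zero]
      by_cases hK : x < k - c ∨ x < b - f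
      · rw [finsum_termK_eq_zero_of_lt t₅ t₂ tb tc hb₃ hb₁ hc₂ hK, mul_zero, zero_mul]
      rw [not_or, not_lt, not_lt] at hK
      rcases lt_or_ge (a + g) x with ha₃ | ha₃
      · rw [finsum_termG_eq_zero_of_gt (b := g) u₁ u₂ ta.swap tb ha₂ hb₃ (by linarith), mul_zero]
      rcases lt_or_ge (c + k) x with hc₃ | hc₃
      · rw [finsum_termG_eq_zero_of_gt u₃ u₄ tc ta.swap hK.1 (by linarith) hc₃, zero_mul, zero_mul]
      exact absurd ⟨⟨ha₁, ha₂, ha₃⟩, ⟨hb₁, hK.2, hb₃⟩, hK.1, hc₂, hc₃⟩ hx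
    rw [hA, hD, mul_zero, mul_zero]

theorem finsum_finsum_finsum_eq_sum {T : ℕ → ℕ → ℕ → ℚ} {n₁ n₂ n₃ : ℕ}
    (h₁ : ∀ z₁ z₂ z₃, n₁ < z₁ → T z₁ z₂ z₃ = 0) (h₂ : ∀ z₁ z₂ z₃, n₂ < z₂ → T z₁ z₂ z₃ = 0)
    (h₃ : ∀ z₁ z₂ z₃, n₃ < z₃ → T z₁ z₂ z₃ = 0) :
    ∑ᶠ z₁, ∑ᶠ z₂, ∑ᶠ z₃, T z₁ z₂ z₃ = ∑ z₁ ∈ Finset.range (n₁ + 1),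
      ∑ z₂ ∈ Finset.range (n₂ + 1), ∑ z₃ ∈ Finset.range (n₃ + 1), T z₁ z₂ z₃ := by
  rw [finsum_eq_sum_range (n := n₁) fun z₁ hz₁ => by simp [h₁ z₁ _ _ hz₁]]
  refine Finset.sum_congr rfl fun z₁ _ => ?_
  rw [finsum_eq_sum_range (n := n₂) fun z₂ hz₂ => by simp [h₂ z₁ z₂ _ hz₂]]
  exact Finset.sum_congr rfl fun z₂ _ => finsum_eq_sum_range (h₃ z₁ z₂)

theorem tripleSum_eq_sum_intermediate {ε : ℚ} {J n₁ n₂ n₃ : ℕ} (A B C p q r : ℕ → ℚ) (hε : ε < 1)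
    (hp : ∀ z, IsInteger (p z - ε)) (hq : ∀ z, IsInteger (q z - ε))
    (hr : ∀ z, IsInteger (r z - ε)) (hpq : ∀ z₂ ≤ n₂, ∀ z₃ ≤ n₃, 0 ≤ p z₂ + q z₃)
    (h2ε : IsInteger (2 * ε)) (hJ : ∀ z ≤ n₁, r z < ε + J) :
    ∑ z₁ ∈ Finset.range (n₁ + 1), ∑ z₂ ∈ Finset.range (n₂ + 1), ∑ z₃ ∈ Finset.range (n₃ + 1),
      A z₁ * B z₂ * C z₃ * (fct (p z₂ + q z₃) / (fct (r z₁ - p z₂) * fct (r z₁ - q z₃))) =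
    ∑ j ∈ Finset.range J, (2 * (ε + j) + 1) *
      ((∑ z ∈ Finset.range (n₁ + 1), A z * (fct (r z + (ε + j) + 1) * fct (r z - (ε + j)))⁻¹) *
      (∑ z ∈ Finset.range (n₂ + 1), B z * (fct (ε + j + p z) / fct (ε + j - p z))) *
      ∑ z ∈ Finset.range (n₃ + 1), C z * (fct (ε + j + q z) / fct (ε + j - q z))) := by
  have hT : ∀ z₁ ∈ Finset.range (n₁ + 1), ∀ z₂ ∈ Finset.range (n₂ + 1),
      ∀ z₃ ∈ Finset.range (n₃ + 1), A z₁ * B z₂ * C z₃ *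
        (fct (p z₂ + q z₃) / (fct (r z₁ - p z₂) * fct (r z₁ - q z₃))) =
      ∑ j ∈ Finset.range J, (2 * (ε + j) + 1) *
        ((A z₁ * (fct (r z₁ + (ε + j) + 1) * fct (r z₁ - (ε + j)))⁻¹) *
        (B z₂ * (fct (ε + j + p z₂) / fct (ε + j - p z₂))) *
        (C z₃ * (fct (ε + j + q z₃) / fct (ε + j - q z₃)))) := by
    intro z₁ hz₁ z₂ hz₂ z₃ hz₃
    simp only [Finset.mem_range, Nat.lt_succ_iff] at hz₁ hz₂ hz₃
    rw [← sum_intermediate hε (hp z₂) (hq z₃) (hr z₁)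
      ((((hp z₂).add (hq z₃)).add h2ε).of_eq (by ring) |>.isNatural (hpq z₂ hz₂ z₃ hz₃))
      (hJ z₁ hz₁), Finset.mul_sum]
    exact Finset.sum_congr rfl fun j _ => by ring
  rw [Finset.sum_congr rfl fun z₁ h₁ => Finset.sum_congr rfl fun z₂ h₂ =>
    Finset.sum_congr rfl fun z₃ h₃ => hT z₁ h₁ z₂ h₂ z₃ h₃]
  rw [Finset.sum_congr rfl fun z₁ _ => Finset.sum_congr rfl fun z₂ _ => Finset.sum_comm,
    Finset.sum_congr rfl fun z₁ _ => Finset.sum_comm, Finset.sum_comm]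
  simp only [← Finset.mul_sum, ← Finset.sum_mul]

/-- `ε` is the fractional part common to all the values of the intermediate spin. -/
theorem sumSA_eq_sum_intermediate {a b c d e f g h k ε : ℚ} {J : ℕ} (t₁ : Triad a b e)
    (t₂ : Triad c d f) (t₃ : Triad h k g) (t₅ : Triad b d k) (t₆ : Triad e f g) (hε : ε < 1)
    (h2ε : IsInteger (2 * ε)) (ha : IsInteger (a + g - ε)) (hc : IsInteger (c + k - ε))
    (hJ : a + g < ε + J) :
    sumSA a b c d e f g h k = ∑ j ∈ Finset.range J, (2 * (ε + j) + 1) *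
      ((∑ᶠ z, termF a c h g k (ε + j) z) * (∑ᶠ z, termG b d k c f (ε + j) z) *
        ∑ᶠ z, termH a b e f g (ε + j) z) := by
  obtain ⟨n₁, hn₁⟩ : IsNatural (g + h - k) := t₃.isNatural₂.of_eq (by ring)
  obtain ⟨n₂, hn₂⟩ : IsNatural (d - b + k) := t₅.isNatural₃.of_eq (by ring)
  obtain ⟨n₃, hn₃⟩ : IsNatural (a + b - e) := t₁.isNatural₁
  have hlt : ∀ {n z : ℕ}, n < z → (n : ℚ) - z < 0 := fun h => sub_neg.mpr (by exact_mod_cast h)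
  have hle : ∀ {n z : ℕ}, z ≤ n → (z : ℚ) ≤ n := fun h => by exact_mod_cast h
  have hF : ∀ x, ∑ᶠ z, termF a c h g k x z = ∑ z ∈ Finset.range (n₁ + 1), termF a c h g k x z :=
    fun x => finsum_eq_sum_range fun z hz => termF_eq_zero (by rw [hn₁]; exact_mod_cast hz)
  have hG : ∀ x, ∑ᶠ z, termG b d k c f x z = ∑ z ∈ Finset.range (n₂ + 1), termG b d k c f x z :=
    fun x => finsum_eq_sum_range fun z hz => termG_eq_zero (by rw [hn₂]; exact_mod_cast hz)
  have hH : ∀ x, ∑ᶠ z, termH a b e f g x z = ∑ z ∈ Finset.range (n₃ + 1), termH a b e f g x z :=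
    fun x => finsum_eq_sum_range fun z hz => termH_eq_zero (by rw [hn₃]; exact_mod_cast hz)
  simp only [hF, hG, hH]
  rw [sumSA, finsum_finsum_finsum_eq_sum (n₁ := n₁) (n₂ := n₂) (n₃ := n₃)]
  · have key := tripleSum_eq_sum_intermediate (J := J) (n₁ := n₁) (n₂ := n₂) (n₃ := n₃)
      (fun z => (-1) ^ z * (fct (g - h + k + z) * fct (a + c - h + z) * fct (2 * h - z) /
        ((z.factorial : ℚ) * fct (g + h - k - z) * fct (c - a + h - z))))
      (fun z => (-1) ^ z * (fct (2 * d - z) * fct (c - d + f + z) /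
        ((z.factorial : ℚ) * fct (d - b + k - z) * fct (c + d - f - z) *
          fct (b + d + k + 1 - z))))
      (fun z => (-1) ^ z * (fct (b + e - a + z) * fct (e - f + g + z) /
        ((z.factorial : ℚ) * fct (a + b - e - z) * fct (f + g - e - z) * fct (2 * e + 1 + z))))
      (fun z => d + k - f - z) (fun z => a + f - e - z) (fun z => a + k - h + z) hε
      (fun z => ((hc.sub t₂.isNatural₂.isInteger).sub (isInteger_natCast z)).of_eq (by ring))
      (fun z => ((ha.sub t₆.isNatural₂.isInteger).sub (isInteger_natCast z)).of_eq (by ring))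
      (fun z => ((ha.sub t₃.isNatural₂.isInteger).add (isInteger_natCast z)).of_eq (by ring))
      (fun z₂ h₂ z₃ h₃ => by linarith [hle h₂, hle h₃]) h2ε
      (fun z hz => by linarith [hle hz])
    convert key using 1
    · refine Finset.sum_congr rfl fun z₁ _ => ?_
      refine Finset.sum_congr rfl fun z₂ _ => ?_
      refine Finset.sum_congr rfl fun z₃ _ => ?_
      rw [show d + k - f - z₂ + (a + f - e - z₃) = a + d - e + k - z₂ - z₃ by ring,
        show a + k - h + z₁ - (d + k - f - z₂) = a - d + f - h + z₁ + z₂ by ring,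
        show a + k - h + z₁ - (a + f - e - z₃) = e - f - h + k + z₁ + z₃ by ring]
      ring
    · refine Finset.sum_congr rfl fun j _ => ?_
      congr 3
      · refine Finset.sum_congr rfl fun z _ => ?_
        rw [termF, show a + k - h + z + (ε + j) + 1 = a + k - h + (ε + j) + 1 + z by ring,
          show a + k - h + z - (ε + j) = a + k - h - (ε + j) + z by ring]
      · refine Finset.sum_congr rfl fun z _ => ?_
        rw [termG, show ε + j + (d + k - f - z) = ε + j + d + k - f - z by ring,
          show ε + j - (d + k - f - z) = ε + j + f - d - k + z by ring]
      · funext z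
        rw [termH, show ε + j + (a + f - e - z) = ε + j + a + f - e - z by ring,
          show ε + j - (a + f - e - z) = ε + j + e - a - f + z by ring]
  · intro z₁ z₂ z₃ hz
    rw [hn₁, fct_of_neg (hlt hz)]
    simp
  · intro z₁ z₂ z₃ hz
    rw [hn₂, fct_of_neg (hlt hz)]
    simp
  · intro z₁ z₂ z₃ hz
    rw [hn₃, fct_of_neg (hlt hz)]
    simp

theorem sumSD_eq_sum_intermediate {a b c d e f g h k ε : ℚ} {J : ℕ} (t₁ : Triad a b e)
    (t₃ : Triad h k g) (t₅ : Triad b d k) (t₆ : Triad e f g) (hε : ε < 1)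
    (h2ε : IsInteger (2 * ε)) (ha : IsInteger (a + g - ε)) (hb : IsInteger (b + f - ε))
    (hJ : b + f < ε + J) :
    sumSD a b c d e f g h k = ∑ j ∈ Finset.range J, (2 * (ε + j) + 1) *
      ((∑ᶠ z, termG c h a g k (ε + j) z) * (∑ᶠ z, termK b d k c f (ε + j) z) *
        ∑ᶠ z, termG g e f b a (ε + j) z) := by
  obtain ⟨n₁, hn₁⟩ : IsNatural (g + h - k) := t₃.isNatural₂.of_eq (by ring)
  obtain ⟨n₂, hn₂⟩ : IsNatural (b - d + k) := t₅.isNatural₂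
  obtain ⟨n₃, hn₃⟩ : IsNatural (e + f - g) := t₆.isNatural₁
  have hlt : ∀ {n z : ℕ}, n < z → (n : ℚ) - z < 0 := fun h => sub_neg.mpr (by exact_mod_cast h)
  have hle : ∀ {n z : ℕ}, z ≤ n → (z : ℚ) ≤ n := fun h => by exact_mod_cast h
  have hG : ∀ x, ∑ᶠ z, termG c h a g k x z = ∑ z ∈ Finset.range (n₁ + 1), termG c h a g k x z :=
    fun x => finsum_eq_sum_range fun z hz => termG_eq_zero' (by rw [hn₁]; exact_mod_cast hz)
  have hK : ∀ x, ∑ᶠ z, termK b d k c f x z = ∑ z ∈ Finset.range (n₂ + 1), termK b d k c f x z :=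
    fun x => finsum_eq_sum_range fun z hz => termK_eq_zero (by rw [hn₂]; exact_mod_cast hz)
  have hG' : ∀ x, ∑ᶠ z, termG g e f b a x z = ∑ z ∈ Finset.range (n₃ + 1), termG g e f b a x z :=
    fun x => finsum_eq_sum_range fun z hz => termG_eq_zero (by
      rw [show e - g + f = n₃ by linarith]
      exact_mod_cast hz)
  simp only [hG, hK, hG']
  rw [sumSD, finsum_finsum_finsum_eq_sum (n₁ := n₁) (n₂ := n₂) (n₃ := n₃), Finset.sum_comm]
  · have key := tripleSum_eq_sum_intermediate (J := J) (n₁ := n₂) (n₂ := n₁) (n₃ := n₃)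
      (fun z => (-1) ^ z * (fct (2 * b - z) * fct (b - c + f + k - z) *
        fct (b + c + f + k + 1 - z) /
        ((z.factorial : ℚ) * fct (b - d + k - z) * fct (b + d + k + 1 - z))))
      (fun z => (-1) ^ z * (fct (2 * h - z) * fct (g - h + k + z) /
        ((z.factorial : ℚ) * fct (h - c + a - z) * fct (g + h - k - z) *
          fct (c + h + a + 1 - z))))
      (fun z => (-1) ^ z * (fct (2 * e - z) * fct (b - e + a + z) /
        ((z.factorial : ℚ) * fct (e - g + f - z) * fct (b + e - a - z) *
          fct (g + e + f + 1 - z))))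
      (fun z => a + h - k - z) (fun z => e + f - a - z) (fun z => b + f - z) hε
      (fun z => ((ha.sub t₃.isNatural₃.isInteger).sub (isInteger_natCast z)).of_eq (by ring))
      (fun z => ((hb.sub t₁.isNatural₁.isInteger).sub (isInteger_natCast z)).of_eq (by ring))
      (fun z => (hb.sub (isInteger_natCast z)).of_eq (by ring))
      (fun z₂ h₂ z₃ h₃ => by linarith [hle h₂, hle h₃]) h2ε
      (fun z hz => by
        have : (0 : ℚ) ≤ z := by positivity
        linarith)
    convert key using 1
    · refine Finset.sum_congr rfl fun z₂ _ => ?_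
      refine Finset.sum_congr rfl fun z₁ _ => ?_
      refine Finset.sum_congr rfl fun z₃ _ => ?_
      rw [show a + h - k - z₁ + (e + f - a - z₃) = e + f + h - k - z₁ - z₃ by ring,
        show b + f - z₂ - (a + h - k - z₁) = b + f - h + k - a + z₁ - z₂ by ring,
        show b + f - z₂ - (e + f - a - z₃) = a + b - e - z₂ + z₃ by ring,
        show h - c + a = a - c + h by ring, show c + h + a + 1 = a + c + h + 1 by ring,
        show b - e + a = a + b - e by ring, show e - g + f = e + f - g by ring,
        show b + e - a = b - a + e by ring, show g + e + f + 1 = e + f + g + 1 by ring]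
      ring
    · refine Finset.sum_congr rfl fun j _ => ?_
      rw [mul_comm (∑ z ∈ Finset.range (n₁ + 1), _)]
      congr 3
      · refine Finset.sum_congr rfl fun z _ => ?_
        rw [termK, show b + f - z + (ε + j) + 1 = b + f + (ε + j) + 1 - z by ring,
          show b + f - z - (ε + j) = b + f - (ε + j) - z by ring]
      · refine Finset.sum_congr rfl fun z _ => ?_
        rw [termG, show ε + j + (a + h - k - z) = ε + j + h + a - k - z by ring,
          show ε + j - (a + h - k - z) = ε + j + k - h - a + z by ring]
      · funext z
        rw [termG, show ε + j + (e + f - a - z) = ε + j + e + f - a - z by ring,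
          show ε + j - (e + f - a - z) = ε + j + a - e - f + z by ring]
  · intro z₁ z₂ z₃ hz
    rw [hn₁, fct_of_neg (hlt hz)]
    simp
  · intro z₁ z₂ z₃ hz
    rw [hn₂, fct_of_neg (hlt hz)]
    simp
  · intro z₁ z₂ z₃ hz
    rw [hn₃, fct_of_neg (hlt hz)]
    simp

/-- Equality of the Ališauskas–Jucys triple-sum formula for the SU(2) 9j
coefficient `{a b e; c d f; h k g}` and the new triple-sum formula obtained from
expansion (trsd) of the paper. -/
theorem nineJ_tripleSum_A_eq_D (a b c d e f g h k : ℚ)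
    (ha : IsNNHalfInt a) (hb : IsNNHalfInt b) (hc : IsNNHalfInt c)
    (hd : IsNNHalfInt d) (he : IsNNHalfInt e) (hf : IsNNHalfInt f)
    (hg : IsNNHalfInt g) (hh : IsNNHalfInt h) (hk : IsNNHalfInt k)
    (t1 : Triad a b e) (t2 : Triad c d f) (t3 : Triad h k g)
    (t4 : Triad a c h) (t5 : Triad b d k) (t6 : Triad e f g) :
    neg1pw (c + h - a) * Nsq a b e * sumSA a b c d e f g h k =
      neg1pw (b - a + f - g) * Nsq a c h * sumSD a b c d e f g h k := by
  obtain ⟨ε, hε, hε₀, ha₀⟩ : ∃ ε : ℚ, ε < 1 ∧ 0 ≤ ε ∧ IsInteger (a + g - ε) :=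
    ⟨Int.fract (a + g), Int.fract_lt_one _, Int.fract_nonneg _, ⌊a + g⌋, by
      rw [Int.fract]
      ring⟩
  have hb₀ : IsInteger (b + f - ε) :=
    (ha₀.sub (t1.isNatural₂.isInteger.sub t6.isNatural₁.isInteger)).of_eq (by ring)
  have hc₀ : IsInteger (c + k - ε) :=
    (ha₀.sub (t4.isNatural₂.isInteger.sub t3.isNatural₁.isInteger)).of_eq (by ring)
  have ha₂ : IsInteger (2 * a) := ha.2
  have hb₂ : IsInteger (2 * b) := hb.2
  have hc₂ : IsInteger (2 * c) := hc.2
  have hf₂ : IsInteger (2 * f) := hf.2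
  have hg₂ : IsInteger (2 * g) := hg.2
  have hk₂ : IsInteger (2 * k) := hk.2
  have h2ε : IsInteger (2 * ε) := ((ha₂.add hg₂).sub (ha₀.add ha₀)).of_eq (by ring)
  have hT : ∀ {y z : ℚ} (j : ℕ), IsInteger (2 * y) → IsInteger (2 * z) → IsInteger (y + z - ε) →
      IntegralTriad y z (ε + j) := fun j hy hz hyz => by
    have hj := hyz.sub (isInteger_natCast j)
    exact ⟨hj.of_eq (by ring), (hy.sub hj).of_eq (by ring), (hz.sub hj).of_eq (by ring)⟩
  obtain ⟨J, hJ⟩ := exists_nat_gt (max (a + g) (b + f))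
  rw [max_lt_iff] at hJ
  rw [sumSA_eq_sum_intermediate (J := J) t1 t2 t3 t5 t6 hε h2ε ha₀ hc₀ (by linarith),
    sumSD_eq_sum_intermediate (J := J) t1 t3 t5 t6 hε h2ε ha₀ hb₀ (by linarith), Finset.mul_sum,
    Finset.mul_sum]
  refine Finset.sum_congr rfl fun j _ => ?_
  linear_combination (2 * (ε + j) + 1) * product_A_eq_product_D t1 t2 t3 t4 t5 t6
    (hT j ha₂ hg₂ ha₀) (hT j hb₂ hf₂ hb₀) (hT j hc₂ hk₂ hc₀)
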